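/- arXiv:2506.02885 — 3 statements merged into one kernel-verified Lean document; each statement's English description precedes it below -/
import Mathlib

section
/- Let G be a finite non-solvable group. Then the intersection of all non-nilpotent maximal subgroups of G is nilpotent. -/
universe u

open Subgroup

/-- `G` has a normal `p`-complement: a normal subgroup of order prime to `p` modulo which every
element has `p`-power order. -/
def HasNormalPComplement (p : ℕ) (G : Type*) [Group G] : Prop :=
  ∃ K : Subgroup G, K.Normal ∧ ¬ p ∣ Nat.card K ∧ ∀ g : G, ∃ n : ℕ, g ^ p ^ n ∈ K

section Basic

variable {p : ℕ} {G G' : Type*} [Group G] [Group G']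

lemma not_dvd_orderOf_of_mem {K : Subgroup G} (hK : ¬ p ∣ Nat.card K) {g : G}
    (hg : g ∈ K) : ¬ p ∣ orderOf g := fun h ↦
  hK (h.trans (by simpa using orderOf_dvd_natCard (⟨g, hg⟩ : K)))

lemma mem_of_pow_mem_of_not_dvd_orderOf [Fact p.Prime] {K : Subgroup G} {g : G} {n : ℕ}
    (hg : g ^ p ^ n ∈ K) (h : ¬ p ∣ orderOf g) : g ∈ K := by
  have hc : (orderOf g).Coprime (p ^ n) :=
    (((Fact.out : p.Prime).coprime_iff_not_dvd.mpr h).pow_left n).symm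
  obtain ⟨m, hm⟩ := exists_pow_eq_self_of_coprime hc.symm
  exact hm ▸ K.pow_mem hg m

lemma mem_iff_not_dvd_orderOf [Fact p.Prime] {K : Subgroup G} (hK : ¬ p ∣ Nat.card K)
    (hp : ∀ g : G, ∃ n : ℕ, g ^ p ^ n ∈ K) {g : G} : g ∈ K ↔ ¬ p ∣ orderOf g :=
  ⟨not_dvd_orderOf_of_mem hK, fun h ↦ mem_of_pow_mem_of_not_dvd_orderOf (hp g).choose_spec h⟩

lemma not_dvd_natCard_of_forall_mem [Finite G] [Fact p.Prime] {K : Subgroup G}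
    (h : ∀ g ∈ K, ¬ p ∣ orderOf g) : ¬ p ∣ Nat.card K := fun hp ↦ by
  obtain ⟨g, hg⟩ := exists_prime_orderOf_dvd_card' p hp
  exact h g g.2 (by simp [hg])

lemma IsPGroup.eq_bot_of_not_dvd [Fact p.Prime] {K : Subgroup G} (h : IsPGroup p K)
    (hK : ¬ p ∣ Nat.card K) : K = ⊥ := by
  rw [eq_bot_iff]
  intro g hg
  obtain ⟨n, hn⟩ := h ⟨g, hg⟩
  exact mem_of_pow_mem_of_not_dvd_orderOf (n := n) (by simpa [Subtype.ext_iff] using hn)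
    (not_dvd_orderOf_of_mem hK hg)

lemma HasNormalPComplement.of_injective [Finite G] [Finite G'] [Fact p.Prime]
    (h : HasNormalPComplement p G')
    (f : G →* G') (hf : Function.Injective f) : HasNormalPComplement p G := by
  obtain ⟨K, hK, hc, hp⟩ := h
  refine ⟨K.comap f, inferInstance, not_dvd_natCard_of_forall_mem fun g hg ↦ ?_, fun g ↦ ?_⟩
  · rw [← orderOf_injective f hf]
    exact not_dvd_orderOf_of_mem hc hg
  · obtain ⟨n, hn⟩ := hp (f g)
    exact ⟨n, by simpa using hn⟩

lemma HasNormalPComplement.of_surjective [Finite G] (h : HasNormalPComplement p G)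
    (f : G →* G') (hf : Function.Surjective f) : HasNormalPComplement p G' := by
  obtain ⟨K, hK, hc, hp⟩ := h
  refine ⟨K.map f, hK.map f hf, fun h ↦ hc (h.trans (K.card_map_dvd f)), fun g ↦ ?_⟩
  obtain ⟨g, rfl⟩ := hf g
  obtain ⟨n, hn⟩ := hp g
  exact ⟨n, g ^ p ^ n, hn, map_pow f g _⟩

lemma HasNormalPComplement.mono [Finite G] [Fact p.Prime] {H K : Subgroup G} (hHK : H ≤ K)
    (h : HasNormalPComplement p K) : HasNormalPComplement p H :=
  h.of_injective (inclusion hHK) (inclusion_injective hHK)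

lemma HasNormalPComplement.of_quotient [Finite G] [hp : Fact p.Prime] {N : Subgroup G} [N.Normal]
    (hN : ¬ p ∣ Nat.card N) (h : HasNormalPComplement p (G ⧸ N)) : HasNormalPComplement p G := by
  obtain ⟨K, hK, hc, hpw⟩ := h
  refine ⟨K.comap (QuotientGroup.mk' N), inferInstance,
    not_dvd_natCard_of_forall_mem fun g hg hd ↦ ?_, fun g ↦ ?_⟩
  · have h1 : ¬ p ∣ orderOf (QuotientGroup.mk' N g) := not_dvd_orderOf_of_mem hc hg
    have h2 : g ^ orderOf (QuotientGroup.mk' N g) ∈ N := by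
      rw [← QuotientGroup.eq_one_iff]
      exact pow_orderOf_eq_one (QuotientGroup.mk' N g)
    have h3 := not_dvd_orderOf_of_mem hN h2
    rw [orderOf_pow] at h3
    apply h3
    have h4 : orderOf g = (orderOf g / (orderOf g).gcd (orderOf (QuotientGroup.mk' N g))) *
      (orderOf g).gcd (orderOf (QuotientGroup.mk' N g)) :=
        (Nat.div_mul_cancel (Nat.gcd_dvd_left _ _)).symm
    rw [h4] at hd
    exact (hp.out.dvd_mul.mp hd).resolve_right fun h ↦ h1 (h.trans (Nat.gcd_dvd_right _ _))
  · obtain ⟨n, hn⟩ := hpw (QuotientGroup.mk' N g)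
    exact ⟨n, by simpa using hn⟩

/-- A normal `p`-complement of a normal subgroup is normal in the whole group. -/
lemma HasNormalPComplement.exists_normal_le [Finite G] [Fact p.Prime] {N : Subgroup G}
    (hN : N.Normal) (h : HasNormalPComplement p N) :
    ∃ K : Subgroup G, K.Normal ∧ K ≤ N ∧ ¬ p ∣ Nat.card K ∧ ∀ g ∈ N, ∃ n : ℕ, g ^ p ^ n ∈ K := by
  obtain ⟨K, hK, hc, hpw⟩ := h
  have hmem {x : G} : x ∈ K.map N.subtype ↔ x ∈ N ∧ ¬ p ∣ orderOf x := by
    constructor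
    · rintro ⟨y, hy, rfl⟩
      exact ⟨y.2, by simpa using not_dvd_orderOf_of_mem hc hy⟩
    · rintro ⟨hx, ho⟩
      exact ⟨⟨x, hx⟩, (mem_iff_not_dvd_orderOf hc hpw).mpr (by simpa using ho), rfl⟩
  refine ⟨K.map N.subtype, ⟨fun x hx g ↦ ?_⟩, map_subtype_le K,
    fun h ↦ hc (h.trans (K.card_map_dvd _)), fun g hg ↦ ?_⟩
  · rw [hmem] at hx ⊢
    refine ⟨hN.conj_mem x hx.1 g, ?_⟩
    rw [← MulAut.conj_apply, MulEquiv.orderOf_eq]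
    exact hx.2
  · obtain ⟨n, hn⟩ := hpw ⟨g, hg⟩
    exact ⟨n, _, hn, by simp⟩

lemma Group.IsNilpotent.hasNormalPComplement [Finite G] [hp : Fact p.Prime]
    [h : Group.IsNilpotent G] : HasNormalPComplement p G := by
  by_cases hd : p ∣ Nat.card G
  · obtain ⟨e⟩ := (Group.isNilpotent_of_finite_tfae (G := G) |>.out 0 4 rfl rfl).mp h
    let P : Sylow p G := default
    have hpG : p ∈ (Nat.card G).primeFactors :=
      Nat.mem_primeFactors.mpr ⟨hp.out, hd, Nat.card_pos.ne'⟩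
    let f : G →* P := ((Pi.evalMonoidHom (fun P : Sylow p G ↦ P) P).comp
      (Pi.evalMonoidHom (fun p : (Nat.card G).primeFactors ↦ ∀ P : Sylow p G, P) ⟨p, hpG⟩)).comp
      e.symm.toMonoidHom
    refine ⟨f.ker, inferInstance, fun hdf ↦ ?_, fun g ↦ ?_⟩
    · obtain ⟨⟨g, hg⟩, hgo⟩ := exists_prime_orderOf_dvd_card' p hdf
      rw [orderOf_mk] at hgo
      have h1 : e.symm g = 1 := by
        ext ⟨q, hq⟩ Q : 2
        have : Fact q.Prime := ⟨Nat.prime_of_mem_primeFactors hq⟩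
        by_cases hqp : q = p
        · subst hqp
          have : Subsingleton (Sylow q G) := by
            have := Sylow.unique_of_normal P inferInstance
            infer_instance
          rw [Subsingleton.elim Q P]
          exact hg
        · have h2 : (e.symm g ⟨q, hq⟩ Q) ^ p = 1 := by
            have : (e.symm g) ^ p = 1 := by rw [← map_pow, ← hgo, pow_orderOf_eq_one, map_one]
            exact congr_fun (congr_fun this ⟨q, hq⟩) Q
          obtain ⟨n, hn⟩ := Q.2 (e.symm g ⟨q, hq⟩ Q)
          have h3 := Nat.dvd_gcd (orderOf_dvd_of_pow_eq_one h2) (orderOf_dvd_of_pow_eq_one hn)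
          rw [Nat.Coprime.gcd_eq_one] at h3
          · exact orderOf_eq_one_iff.mp (Nat.dvd_one.mp h3)
          · exact ((Nat.coprime_primes hp.out this.out).mpr (Ne.symm hqp)).pow_right n
      have h2 : g = 1 := by simpa using h1
      rw [h2, orderOf_one] at hgo
      exact hp.out.one_lt.ne hgo
    · obtain ⟨n, hn⟩ := P.2 (f g)
      exact ⟨n, by rw [MonoidHom.mem_ker, map_pow, hn]⟩
  · exact ⟨⊤, inferInstance, by simpa using hd, fun g ↦ ⟨0, trivial⟩⟩

lemma Sylow.sup_eq_top_of_forall_pow_mem [Finite G] [hp : Fact p.Prime] (P : Sylow p G)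
    {K : Subgroup G} [K.Normal] (hK : ∀ g : G, ∃ n : ℕ, g ^ p ^ n ∈ K) : K ⊔ P = ⊤ := by
  have h : IsPGroup p (G ⧸ K) := fun g ↦ by
    obtain ⟨g, rfl⟩ := QuotientGroup.mk'_surjective K g
    obtain ⟨n, hn⟩ := hK g
    exact ⟨n, by rw [← map_pow]; exact (QuotientGroup.eq_one_iff _).mpr hn⟩
  obtain ⟨n, hn⟩ := IsPGroup.iff_card.mp h
  have h1 : (K ⊔ P).index ∣ p ^ n := by
    rw [← hn]; exact index_dvd_of_le (le_sup_left : K ≤ K ⊔ P)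
  have h2 : ¬ p ∣ (K ⊔ P).index := fun h ↦
    P.not_dvd_index (h.trans (index_dvd_of_le le_sup_right))
  obtain ⟨m, -, hm⟩ := (Nat.dvd_prime_pow hp.out).mp h1
  rw [← index_eq_one, hm]
  rcases m with _ | m
  · simp
  · exact absurd (hm ▸ dvd_pow_self p (by simp)) h2

lemma IsPGroup.lt_normalizer_inf [Finite G] [Fact p.Prime] {X P : Subgroup G} (hP : IsPGroup p P)
    (h : X < P) : X < normalizer X ⊓ P := by
  have := hP.isNilpotent
  have h1 : X.subgroupOf P < ⊤ := lt_top_iff_ne_top.mpr fun h2 ↦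
    h.not_ge (subgroupOf_eq_top.mp h2)
  have h2 := Group.normalizerCondition_of_isNilpotent (G := P) _ h1
  obtain ⟨x, hx, hx'⟩ := SetLike.exists_of_lt h2
  refine lt_of_le_of_ne (le_inf le_normalizer h.le) fun he ↦ hx' ?_
  rw [mem_subgroupOf, he]
  refine ⟨?_, x.2⟩
  rw [← subgroupOf_normalizer_eq h.le] at hx
  exact hx

end Basic

section Frobenius

open Pointwise
open scoped commutatorElement

variable {p : ℕ} {G : Type u} [Group G]

lemma Subgroup.commute_of_disjoint_of_normal {A B : Subgroup G} (hA : A.Normal) (hB : B.Normal)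
    (h : A ⊓ B = ⊥) {a b : G} (ha : a ∈ A) (hb : b ∈ B) : a * b = b * a :=
  commute_of_normal_of_disjoint A B hA hB (disjoint_iff.mpr h) a b ha hb

lemma inf_eq_bot_of_not_dvd_of_isPGroup [hp : Fact p.Prime] {K X : Subgroup G}
    (hK : ¬ p ∣ Nat.card K) (hX : IsPGroup p X) : K ⊓ X = ⊥ := by
  rw [eq_bot_iff]
  rintro g ⟨hg, hgX⟩
  obtain ⟨n, hn⟩ := hX ⟨g, hgX⟩
  have : g ^ p ^ n = 1 := by simpa [Subtype.ext_iff] using hn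
  exact mem_of_pow_mem_of_not_dvd_orderOf (n := n) (by rw [this]; exact one_mem _)
    (not_dvd_orderOf_of_mem hK hg)

/-- In a group with a normal `p`-complement, two Sylow subgroups are conjugate by an element
of the centralizer of any given normal `p`-subgroup. -/
lemma HasNormalPComplement.exists_smul_sylow_eq [Finite G] [Fact p.Prime]
    (h : HasNormalPComplement p G) {X : Subgroup G} (hXn : X.Normal) (hX : IsPGroup p X)
    (S T : Sylow p G) : ∃ k ∈ centralizer (X : Set G), k • S = T := by
  obtain ⟨K, hK, hc, hpw⟩ := h
  obtain ⟨g, rfl⟩ := MulAction.exists_smul_eq G S T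
  have hg : g ∈ K ⊔ S := by rw [S.sup_eq_top_of_forall_pow_mem hpw]; trivial
  rw [mem_sup_of_normal_left] at hg
  obtain ⟨k, hk, s, hs, rfl⟩ := hg
  refine ⟨k, fun x hx ↦ ?_, ?_⟩
  · exact (commute_of_disjoint_of_normal hK hXn (inf_eq_bot_of_not_dvd_of_isPGroup hc hX)
      hk hx).symm
  · rw [mul_smul, Sylow.smul_eq_iff_mem_normalizer.mpr (le_normalizer hs)]

lemma Sylow.exists_conj_of_inf_le_normalizer [Finite G] [Fact p.Prime] {X : Subgroup G}
    (hX : IsPGroup p X) (h : HasNormalPComplement p (normalizer (X : Set G))) {A B : Subgroup G}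
    (hA : IsPGroup p A) (hB : IsPGroup p B) (hAX : A ≤ normalizer (X : Set G))
    (hBX : B ≤ normalizer (X : Set G)) :
    ∃ (P : Sylow p G) (k : G), k ∈ centralizer (X : Set G) ∧ A ≤ P ∧
      B ≤ (k • P : Sylow p G) := by
  set N := normalizer (X : Set G)
  obtain ⟨S, hS⟩ := (hA.comap_subtype (K := N)).exists_le_sylow
  obtain ⟨T, hT⟩ := (hB.comap_subtype (K := N)).exists_le_sylow
  obtain ⟨k, hk, rfl⟩ := h.exists_smul_sylow_eq (X := X.subgroupOf N) inferInstance
    hX.comap_subtype S T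
  obtain ⟨P, hP⟩ := (S.2.map N.subtype).exists_le_sylow
  refine ⟨P, k, fun x hx ↦ ?_, fun a ha ↦ ?_, fun b hb ↦ ?_⟩
  · have := hk ⟨x, le_normalizer hx⟩ (by exact hx)
    simpa [Subtype.ext_iff] using this
  · exact hP ⟨⟨a, hAX ha⟩, hS (by exact ha), rfl⟩
  · have h1 : (⟨b, hBX hb⟩ : N) ∈ (k • S : Sylow p N) := hT (by exact hb)
    obtain ⟨s, hs, hsb⟩ := h1
    refine ⟨s, hP ⟨s, hs, rfl⟩, ?_⟩
    simpa [Subtype.ext_iff] using hsb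

/-- If all `p`-local subgroups have normal `p`-complements, then two Sylow `p`-subgroups are
conjugate by an element centralizing their intersection. -/
lemma Sylow.exists_mem_centralizer_smul_eq [Finite G] [Fact p.Prime]
    (h : ∀ X : Subgroup G, X ≠ ⊥ → IsPGroup p X → HasNormalPComplement p (normalizer (X : Set G)))
    (P R : Sylow p G) :
    ∃ c ∈ centralizer ((P ⊓ R : Subgroup G) : Set G), c • P = R := by
  induction hn : Nat.card G - Nat.card (P ⊓ R : Subgroup G) using Nat.strong_induction_on
    generalizing P R with
  | _ n ih =>
  subst hn
  have key {A B C : Subgroup G} (hA : A < B) (hB : B ≤ C) :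
      Nat.card G - Nat.card C < Nat.card G - Nat.card A := by
    have h1 : Nat.card A < Nat.card C := by
      simpa using Set.Finite.card_lt_card (Set.toFinite (C : Set G)) (hA.trans_le hB)
    have h2 : Nat.card C ≤ Nat.card G := Subgroup.card_le_card_group C
    omega
  by_cases hbot : (P ⊓ R : Subgroup G) = ⊥
  · obtain ⟨g, hg⟩ := MulAction.exists_smul_eq G P R
    refine ⟨g, ?_, hg⟩
    rw [hbot]
    simp [mem_centralizer_iff]
  by_cases hPR : (P : Subgroup G) ≤ R
  · refine ⟨1, one_mem _, ?_⟩
    rw [one_smul]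
    exact Sylow.ext (P.3 R.2 hPR).symm
  have hRP : ¬ (R : Subgroup G) ≤ P := fun hle ↦ hPR (R.3 P.2 hle).le
  set X := (P ⊓ R : Subgroup G) with hXdef
  have hX : IsPGroup p X := P.2.to_le inf_le_left
  have h1 := P.2.lt_normalizer_inf (X := X) (lt_of_le_of_ne inf_le_left fun he ↦
    hPR (he ▸ inf_le_right))
  have h2 := R.2.lt_normalizer_inf (X := X) (lt_of_le_of_ne inf_le_right fun he ↦
    hRP (he ▸ inf_le_left))
  obtain ⟨P1, k, hk, hA, hB⟩ := Sylow.exists_conj_of_inf_le_normalizer hX (h X hbot hX)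
    (P.2.to_le inf_le_right) (R.2.to_le inf_le_right)
    (inf_le_left : normalizer (X : Set G) ⊓ P ≤ _) (inf_le_left : normalizer (X : Set G) ⊓ R ≤ _)
  have hle1 : normalizer (X : Set G) ⊓ P ≤ (P ⊓ P1 : Subgroup G) := le_inf inf_le_right hA
  have hle2 : normalizer (X : Set G) ⊓ R ≤ ((k • P1 : Sylow p G) ⊓ R : Subgroup G) :=
    le_inf hB inf_le_right
  obtain ⟨c1, hc1, e1⟩ := ih _ (key h1 hle1) P P1 rfl
  obtain ⟨c2, hc2, e2⟩ := ih _ (key h2 hle2) (k • P1) R rfl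
  refine ⟨c2 * k * c1, mul_mem (mul_mem ?_ hk) ?_, ?_⟩
  · exact centralizer_le (SetLike.coe_subset_coe.mpr (h2.le.trans hle2)) hc2
  · exact centralizer_le (SetLike.coe_subset_coe.mpr (h1.le.trans hle1)) hc1
  · rw [mul_smul, mul_smul, e1, e2]

lemma Sylow.focalSubgroup_le_commutator_self [Finite G] [Fact p.Prime]
    (h : ∀ X : Subgroup G, X ≠ ⊥ → IsPGroup p X → HasNormalPComplement p (normalizer (X : Set G)))
    (P : Sylow p G) (hP : (P : Subgroup G) ≠ ⊥) :
    (P : Subgroup G).focalSubgroup ≤ ⁅(P : Subgroup G), (P : Subgroup G)⁆ := by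
  rw [focalSubgroup_def, closure_le]
  rintro _ ⟨hz, x, hx, u, rfl⟩
  have hy : u * x * u⁻¹ ∈ P := by
    have h1 : x⁻¹ * ⁅x, u⁆ ∈ (P : Subgroup G) := mul_mem (inv_mem hx) hz
    have h2 := inv_mem h1
    rwa [show (x⁻¹ * ⁅x, u⁆)⁻¹ = u * x * u⁻¹ by rw [commutatorElement_def]; group] at h2
  have hxR : x ∈ (u⁻¹ • P : Sylow p G) :=
    ⟨_, hy, by simp [mul_assoc]⟩
  obtain ⟨c, hc, he⟩ := Sylow.exists_mem_centralizer_smul_eq h P (u⁻¹ • P)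
  have hcx : x * c = c * x := hc x ⟨hx, hxR⟩
  have hn : u * c ∈ normalizer ((P : Subgroup G) : Set G) :=
    Sylow.smul_eq_iff_mem_normalizer.mp (by rw [mul_smul, he, smul_inv_smul])
  obtain ⟨K, hK, hKc, hKp⟩ := h P hP P.2
  have hsup := (P.subtype le_normalizer).sup_eq_top_of_forall_pow_mem hKp
  have hmem : (⟨u * c, hn⟩ : normalizer ((P : Subgroup G) : Set G)) ∈
    K ⊔ (P.subtype le_normalizer : Subgroup _) := by rw [hsup]; trivial
  rw [mem_sup_of_normal_left] at hmem
  obtain ⟨k, hk, ⟨s, hsN⟩, hs, hks⟩ := hmem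
  replace hks : u * c = k * s := (congr_arg Subtype.val hks).symm
  replace hs : s ∈ (P : Subgroup G) := hs
  have hcomm : ∀ y ∈ (P : Subgroup G), (k : G) * y = y * k := fun y hy ↦ by
    have := Subgroup.commute_of_disjoint_of_normal hK
      (inferInstance : ((P : Subgroup G).subgroupOf (normalizer ((P : Subgroup G) : Set G))).Normal)
      (inf_eq_bot_of_not_dvd_of_isPGroup hKc P.2.comap_subtype) hk
      (b := ⟨y, le_normalizer hy⟩) (by exact hy)
    exact congr_arg Subtype.val this
  have hux : u * x * u⁻¹ = s * x * s⁻¹ := by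
    calc u * x * u⁻¹ = (u * c) * x * (u * c)⁻¹ := by
          rw [mul_inv_rev, mul_assoc u c x, ← hcx]; group
      _ = k * (s * x * s⁻¹) * (k : G)⁻¹ := by rw [hks]; group
      _ = s * x * s⁻¹ := by
          rw [hcomm _ (mul_mem (mul_mem hs hx) (inv_mem hs)), mul_inv_cancel_right]
  have hxu : ⁅x, u⁆ = ⁅x, s⁆ := by
    have h1 : ∀ v : G, ⁅x, v⁆ = x * (v * x * v⁻¹)⁻¹ := fun v ↦ by
      rw [commutatorElement_def]; group
    rw [h1, h1, hux]
  rw [hxu]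
  exact commutator_mem_commutator hx hs

/-- **Frobenius' criterion** for the existence of a normal `p`-complement. -/
theorem hasNormalPComplement_of_normalizer [Finite G] [hp : Fact p.Prime]
    (h : ∀ X : Subgroup G, X ≠ ⊥ → IsPGroup p X →
      HasNormalPComplement p (normalizer (X : Set G))) : HasNormalPComplement p G := by
  induction hn : Nat.card G using Nat.strong_induction_on generalizing G with
  | _ n ih =>
  subst hn
  by_cases hd : p ∣ Nat.card G
  swap
  · exact ⟨⊤, inferInstance, by simpa using hd, fun g ↦ ⟨0, trivial⟩⟩
  let P : Sylow p G := default
  have hP : (P : Subgroup G) ≠ ⊥ := P.ne_bot_of_dvd_card hd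
  have hlt : (P : Subgroup G).focalSubgroup < P := by
    have := P.2.isNilpotent
    refine (P.focalSubgroup_le_commutator_self h hP).trans_lt ?_
    have : Nontrivial P := (nontrivial_iff_ne_bot _).mpr hP
    have h1 := Group.IsSolvable.commutator_lt_top_of_nontrivial P
    rw [← map_subtype_commutator]
    refine lt_of_le_of_ne (map_subtype_le _) fun he ↦ h1.ne ?_
    rw [eq_top_iff]
    intro x _
    have hx : (x : G) ∈ map (P : Subgroup G).subtype (commutator P) := he.ge x.2
    obtain ⟨y, hy, hyx⟩ := hx
    rwa [← Subtype.ext hyx]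
  set N := (P : Subgroup G).transferFocal.ker with hN
  have hNt : N ≠ ⊤ := fun he ↦ by
    have := ker_transferFocal_inf_eq_focalSubgroup P
    rw [← hN, he, top_inf_eq] at this
    exact hlt.ne this.symm
  have hNc : Nat.card N < Nat.card G := by
    refine lt_of_le_of_ne (Subgroup.card_le_card_group N) fun he ↦ hNt ?_
    exact eq_top_of_card_eq N he
  have hNp : HasNormalPComplement p N := by
    refine ih _ hNc (fun X hX hXp ↦ ?_) rfl
    have h1 := h (X.map N.subtype) ((map_eq_bot_iff_of_injective _ N.subtype_injective).not.mpr hX)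
      (hXp.map N.subtype)
    refine h1.of_injective ((N.subtype.comp (normalizer (X : Set N)).subtype).codRestrict _
      fun x ↦ le_normalizer_map N.subtype ⟨x, x.2, rfl⟩) ?_
    intro a b hab
    have hab' := Subtype.ext_iff.mp hab
    exact Subtype.ext (Subtype.ext hab')
  obtain ⟨K, hK, -, hKc, hKp⟩ := hNp.exists_normal_le inferInstance
  refine ⟨K, hK, hKc, fun g ↦ ?_⟩
  obtain ⟨n, hn⟩ := P.2.to_quotient (P : Subgroup G).focalSubgroupOf
    ((P : Subgroup G).transferFocal g)
  obtain ⟨m, hm⟩ := hKp (g ^ p ^ n) (by rw [hN, MonoidHom.mem_ker, map_pow, hn])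
  exact ⟨n + m, by rwa [pow_add, pow_mul]⟩

end Frobenius

section Quadratic

/-- If `n ^ 2 = 0` and the conjugates of `x` by `1`, `1 + n` and `1 + 2 * n` commute pairwise,
then the difference of the first two squares to zero. -/
lemma sub_mul_self_eq_zero_of_commute {R : Type*} [Ring R] (h2 : ∀ y : R, 2 * y = 0 → y = 0)
    {n x : R} (hn : n * n = 0)
    (h01 : Commute x ((1 + n) * x * (1 - n)))
    (h02 : Commute x ((1 + n) * ((1 + n) * x * (1 - n)) * (1 - n)))
    (h12 : Commute ((1 + n) * x * (1 - n)) ((1 + n) * ((1 + n) * x * (1 - n)) * (1 - n))) :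
    ((1 + n) * x * (1 - n) - x) * ((1 + n) * x * (1 - n) - x) = 0 := by
  have e1 : (1 + n) * x * (1 - n) = x + (n * x - x * n - n * x * n) := by noncomm_ring
  have e2 : (1 + n) * ((1 + n) * x * (1 - n)) * (1 - n) =
      x + 2 * (n * x - x * n - 2 * (n * x * n)) := by
    have h1 : (1 + n) * (1 + n) = 1 + 2 * n := by linear_combination (norm := noncomm_ring) hn
    have h2 : (1 - n) * (1 - n) = 1 - 2 * n := by linear_combination (norm := noncomm_ring) hn
    calc _ = ((1 + n) * (1 + n)) * x * ((1 - n) * (1 - n)) := by noncomm_ring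
      _ = _ := by rw [h1, h2]; noncomm_ring
  rw [e1] at h01
  rw [e2] at h02
  rw [e2, e1] at h12
  rw [e1, add_sub_cancel_left]
  replace h01 := h01.eq
  replace h02 := h02.eq
  replace h12 := h12.eq
  generalize hB : n * x * n = B at *
  generalize hA : n * x - x * n = A at *
  have hxB : x * B = B * x := by
    refine sub_eq_zero.mp (h2 _ ?_)
    linear_combination (norm := noncomm_ring) 2 * h01 - h02
  have hxA : x * A = A * x := by
    linear_combination (norm := noncomm_ring) h01 + hxB
  have hAB : A * B = B * A := by
    refine sub_eq_zero.mp (h2 _ ?_)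
    linear_combination (norm := noncomm_ring) h02 - h01 - h12
  have hAB' : A * B = - (B * A) := by
    rw [← hA, ← hB]
    linear_combination (norm := noncomm_ring) - x * hn * x * n + n * x * hn * x
  have hAB0 : A * B = 0 := h2 _ (by linear_combination (norm := noncomm_ring) hAB + hAB')
  have hBB : B * B = 0 := by
    rw [← hB]
    linear_combination (norm := noncomm_ring) n * x * hn * x * n
  have hAA : A * A = 0 := by
    have h1 : n * (x * A) = n * (A * x) := by rw [hxA]
    rw [← hB] at hxB
    rw [← hA] at h1 ⊢
    linear_combination (norm := noncomm_ring) h1 + hxB + hn * x * x - x * hn * x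
  linear_combination (norm := noncomm_ring) hAA + hBB - hAB0 - hAB0 + hAB

/-- In characteristic `p ≠ 2`, a unit `a` with `(a - 1) ^ 2 = 0` commutes with an element `x`
of order prime to `p` as soon as the conjugates of `x` under powers of `a` commute. -/
lemma Units.commute_of_commute_conj {R : Type*} [Ring R] {p : ℕ} [hp : Fact p.Prime] (hp2 : p ≠ 2)
    (hpR : (p : R) = 0) (a x : Rˣ) (ha : ((a : R) - 1) * (a - 1) = 0) {k : ℕ} (hk : k ≠ 0)
    (hx : x ^ p ^ k = x) (h1 : Commute x (a * x * a⁻¹))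
    (h2 : Commute x (a * (a * x * a⁻¹) * a⁻¹)) : a * x * a⁻¹ = x := by
  nontriviality R using Subsingleton.elim
  have hchar : CharP R p := (CharP.charP_iff_prime_eq_zero hp.out).mpr hpR
  have htwo : ∀ y : R, 2 * y = 0 → y = 0 := fun y hy ↦ by
    obtain ⟨m, hm⟩ := hp.out.odd_of_ne_two hp2
    have : (p : R) * y = y + m * (2 * y) := by rw [hm]; push_cast; noncomm_ring
    rwa [hpR, hy, zero_mul, mul_zero, add_zero, eq_comm] at this
  have hinv : ((a⁻¹ : Rˣ) : R) = 1 - ((a : R) - 1) := by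
    exact Units.inv_eq_of_mul_eq_one_right (by linear_combination (norm := noncomm_ring) -ha)
  have e0 : (a : R) = 1 + ((a : R) - 1) := by abel
  have h3 : Commute (a * x * a⁻¹) (a * (a * x * a⁻¹) * a⁻¹) := by
    have := congr_arg (fun y ↦ a * y * a⁻¹) h1.eq
    simp only [Commute, SemiconjBy]
    simpa [mul_assoc] using this
  have key := sub_mul_self_eq_zero_of_commute htwo (x := (x : R)) ha
    (by rw [← hinv, ← e0]; simpa using h1.map (Units.coeHom R))
    (by rw [← hinv, ← e0]; simpa using h2.map (Units.coeHom R))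
    (by rw [← hinv, ← e0]; simpa using h3.map (Units.coeHom R))
  rw [← hinv, ← e0] at key
  have hpk : ((a : R) * x * (a⁻¹ : Rˣ) - x) ^ p ^ k = (a : R) * x * (a⁻¹ : Rˣ) - x := by
    have hc : Commute ((a : R) * x * (a⁻¹ : Rˣ)) (x : R) := by
      have := congr_arg Units.val h1.eq
      push_cast at this
      exact this.symm
    rw [sub_pow_char_pow_of_commute _ _ hc]
    have h4 : (a * x * a⁻¹) ^ p ^ k = a * x * a⁻¹ := by rw [_root_.conj_pow, hx]
    have h5 := congr_arg Units.val h4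
    have h6 := congr_arg Units.val hx
    push_cast at h5 h6
    rw [h5, h6]
  have h7 : 2 ≤ p ^ k := hp.out.two_le.trans (Nat.le_self_pow hk p)
  rw [← Nat.add_sub_of_le h7, pow_add, pow_two, key, zero_mul] at hpk
  ext
  push_cast
  exact (sub_eq_zero.mp hpk.symm)

end Quadratic

section Offender

variable {p : ℕ} {A V : Type*} [CommGroup A] [AddCommGroup V] (ρ : A →* AddMonoid.End V)

lemma map_mul_apply (a b : A) (v : V) : ρ (a * b) v = ρ a (ρ b v) := by
  rw [map_mul]
  rfl

/-- The fixed points of a subgroup. -/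
def fixedBy (B : Subgroup A) : AddSubgroup V where
  carrier := {v | ∀ b ∈ B, ρ b v = v}
  zero_mem' := fun b _ ↦ map_zero _
  add_mem' := fun hv hw b hb ↦ by rw [map_add, hv b hb, hw b hb]
  neg_mem' := fun hv b hb ↦ by rw [map_neg, hv b hb]

/-- The commutator `[w, B]`. -/
def displacement (B : Subgroup A) (w : V) : AddSubgroup V :=
  AddSubgroup.closure {v | ∃ b ∈ B, ρ b w - w = v}

/-- The elements of `B` that act trivially on `[w, B]`. -/
def displacementCentralizer (B : Subgroup A) (w : V) : Subgroup A where
  carrier := {b | b ∈ B ∧ ∀ c ∈ B, ρ b (ρ c w - w) = ρ c w - w}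
  one_mem' := ⟨one_mem _, fun c _ ↦ by simp⟩
  mul_mem' := fun ha hb ↦ ⟨mul_mem ha.1 hb.1, fun c hc ↦ by
    rw [map_mul_apply, hb.2 c hc, ha.2 c hc]⟩
  inv_mem' := fun {b} hb ↦ ⟨inv_mem hb.1, fun c hc ↦ by
    conv_lhs => rw [← hb.2 c hc]
    rw [← map_mul_apply, inv_mul_cancel, map_one, AddMonoid.End.one_apply]⟩

variable {ρ}

lemma map_apply_comm (a b : A) (v : V) : ρ a (ρ b v) = ρ b (ρ a v) := by
  rw [← map_mul_apply, mul_comm, map_mul_apply]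

lemma displacementCentralizer_le (B : Subgroup A) (w : V) :
    displacementCentralizer ρ B w ≤ B := fun _ hb ↦ hb.1

lemma sup_le_fixedBy (B : Subgroup A) (w : V) : displacement ρ B w ⊔ fixedBy ρ B ≤
    fixedBy ρ (displacementCentralizer ρ B w) := by
  refine sup_le ((AddSubgroup.closure_le _).mpr ?_) fun v hv b hb ↦ hv b hb.1
  rintro _ ⟨c, hc, rfl⟩ b hb
  exact hb.2 c hc

lemma card_mul_card_fixedBy_le [Finite A] [Finite V] (B : Subgroup A) (w : V) :
    Nat.card B * Nat.card (fixedBy ρ B) ≤ Nat.card (displacementCentralizer ρ B w) *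
      Nat.card (displacement ρ B w ⊔ fixedBy ρ B : AddSubgroup V) := by
  set D := displacementCentralizer ρ B w
  set C := fixedBy ρ B with hC
  set S := displacement ρ B w ⊔ C
  have hS (b : B) : ρ b w - w ∈ S :=
    AddSubgroup.mem_sup_left (AddSubgroup.subset_closure ⟨b, b.2, rfl⟩)
  let F : B → S ⧸ C.addSubgroupOf S := fun b ↦ QuotientAddGroup.mk ⟨ρ b w - w, hS b⟩
  have hF (b c : B) (h : F b = F c) : b⁻¹ * c ∈ D.subgroupOf B := by
    have h1 : ρ c w - ρ b w ∈ C := by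
      have := QuotientAddGroup.eq.mp h
      rw [AddSubgroup.mem_addSubgroupOf] at this
      simpa using this
    refine ⟨(b⁻¹ * c).2, fun d hd ↦ ?_⟩
    have h2 : ρ c (ρ d w - w) = ρ b (ρ d w - w) := by
      have h3 := h1 d hd
      rw [map_sub] at h3
      rw [map_sub, map_sub, map_apply_comm (c : A) d, map_apply_comm (b : A) d]
      rw [sub_eq_sub_iff_sub_eq_sub, h3]
    simp only [coe_subtype, coe_mul, coe_inv, map_mul_apply, h2]
    rw [← map_mul_apply, inv_mul_cancel, map_one, AddMonoid.End.one_apply]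
  have hle : D.relIndex B ≤ C.relIndex S :=
    Nat.card_le_card_of_injective (fun q : B ⧸ D.subgroupOf B ↦ F q.out) fun q r h ↦ by
      rw [← q.out_eq', ← r.out_eq']
      exact QuotientGroup.eq.mpr (hF _ _ h)
  have h1 : Nat.card D * D.relIndex B = Nat.card B :=
    by simpa using relIndex_mul_relIndex ⊥ D B bot_le (displacementCentralizer_le B w)
  have h2 : Nat.card C * C.relIndex S = Nat.card S :=
    by simpa using AddSubgroup.relIndex_mul_relIndex ⊥ C S bot_le le_sup_right
  rw [← h1, ← h2]
  calc _ = Nat.card D * (Nat.card C * D.relIndex B) := by ring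
    _ ≤ _ := by gcongr

lemma fixedBy_eq_top_of_sup_eq_top [Finite V] [hp : Fact p.Prime] (hA : IsPGroup p A)
    (hV : (p : AddMonoid.End V) = 0) (B : Subgroup A) (w : V)
    (h : displacement ρ B w ⊔ fixedBy ρ B = ⊤) : fixedBy ρ B = ⊤ := by
  by_cases hw : w ∈ fixedBy ρ B
  · rw [← h, eq_comm, sup_eq_right, displacement, AddSubgroup.closure_le]
    rintro _ ⟨b, hb, rfl⟩
    rw [hw b hb, sub_self]
    exact zero_mem _
  obtain ⟨U, hU⟩ := (Set.toFinite {U : AddSubgroup V | (∀ b ∈ B, ∀ u ∈ U, ρ b u ∈ U) ∧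
    fixedBy ρ B ≤ U ∧ w ∉ U}).exists_maximal ⟨fixedBy ρ B, fun b hb u hu ↦ (hu b hb).symm ▸ hu,
      le_rfl, hw⟩
  obtain ⟨hUB, hUC, hUw⟩ := hU.prop
  refine absurd ?_ hUw
  suffices hS : displacement ρ B w ⊔ fixedBy ρ B ≤ U by
    rw [h] at hS
    exact hS trivial
  refine sup_le ((AddSubgroup.closure_le _).mpr ?_) hUC
  rintro _ ⟨b, hb, rfl⟩
  by_contra hbw
  let Ub : AddSubgroup V := U.comap (ρ b - 1)
  have hmem (v : V) : v ∈ Ub ↔ ρ b v - v ∈ U := Iff.rfl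
  have hle : U ≤ Ub := fun u hu ↦ (hmem u).mpr (sub_mem (hUB b hb u hu) hu)
  have hge : Ub ≤ U := hU.le_of_ge (y := Ub) ⟨fun c hc v hv ↦ by
    rw [hmem] at hv ⊢
    rw [map_apply_comm, ← map_sub]
    exact hUB c hc _ hv, hUC.trans hle, hbw⟩ hle
  have hpow (n : ℕ) : ∀ v, ((ρ b - 1) ^ n) v ∈ U → v ∈ U := by
    induction n with
    | zero => exact fun v hv ↦ hv
    | succ n ih => exact fun v hv ↦ hge (ih _ (by rwa [pow_succ] at hv))
  obtain ⟨k, hk⟩ := hA b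
  refine hUw (hpow (p ^ k) w ?_)
  have : (ρ b - 1) ^ p ^ k = 0 := by
    nontriviality AddMonoid.End V
    have : CharP (AddMonoid.End V) p := (CharP.charP_iff_prime_eq_zero hp.out).mpr hV
    rw [sub_pow_char_pow_of_commute _ _ (Commute.one_right _), ← map_pow, hk, map_one, one_pow,
      sub_self]
  rw [this]
  exact zero_mem _

/-- An abelian `p`-group acting on an elementary abelian `p`-group `V` with many fixed points
contains an element acting nontrivially and quadratically. -/
theorem exists_quadratic [Finite A] [Finite V] [hp : Fact p.Prime] (hA : IsPGroup p A)
    (hV : (p : AddMonoid.End V) = 0) (B : Subgroup A) (hB : ρ.ker < B)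
    (h : Nat.card ρ.ker * Nat.card V ≤ Nat.card B * Nat.card (fixedBy ρ B)) :
    ∃ a ∈ B, ρ a ≠ 1 ∧ (ρ a - 1) * (ρ a - 1) = 0 := by
  induction hn : Nat.card B using Nat.strong_induction_on generalizing B with
  | _ n ih =>
  subst hn
  obtain ⟨a, haB, ha⟩ := SetLike.exists_of_lt hB
  rw [MonoidHom.mem_ker] at ha
  by_cases hq : ∀ w, displacementCentralizer ρ B w = B
  · refine ⟨a, haB, ha, ?_⟩
    ext w
    have h1 : a ∈ displacementCentralizer ρ B w := (hq w).symm ▸ haB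
    exact sub_eq_zero.mpr (h1.2 a haB)
  push Not at hq
  obtain ⟨w, hw⟩ := hq
  have hlt := lt_of_le_of_ne (displacementCentralizer_le B w) hw
  have hker : ρ.ker ≤ displacementCentralizer ρ B w := fun b hb ↦
    ⟨hB.le hb, fun c _ ↦ by rw [MonoidHom.mem_ker.mp hb, AddMonoid.End.one_apply]⟩
  have hcard := h.trans (card_mul_card_fixedBy_le B w)
  rcases hker.eq_or_lt with he | hlt'
  · rw [← he] at hcard
    have h1 := Nat.le_of_mul_le_mul_left hcard Nat.card_pos
    have h2 := AddSubgroup.eq_top_of_le_card _ h1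
    have h3 := fixedBy_eq_top_of_sup_eq_top hA hV B w h2
    refine absurd ?_ ha
    ext v
    have h4 : v ∈ fixedBy ρ B := h3 ▸ AddSubgroup.mem_top v
    exact h4 a haB
  · obtain ⟨b, hb, hb'⟩ := ih _ (by
      simpa using Set.Finite.card_lt_card (Set.toFinite (B : Set A)) hlt) _ hlt' (hcard.trans
        (Nat.mul_le_mul_left _ (AddSubgroup.card_le_of_le (sup_le_fixedBy B w)))) rfl
    exact ⟨b, hlt.le hb, hb'⟩

end Offender

section Characteristic

variable {p : ℕ} {G G' : Type*} [Group G] [Group G']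

/-- `C` is a characteristic subgroup of the subgroup `P`. -/
def IsCharIn (C P : Subgroup G) : Prop :=
  C ≤ P ∧ ∀ φ : P ≃* P, ∀ x : P, (x : G) ∈ C → (φ x : G) ∈ C

lemma IsCharIn.normalizer_le {C P : Subgroup G} (h : IsCharIn C P) :
    normalizer (P : Set G) ≤ normalizer (C : Set G) :=
  le_normalizer_iff.mpr fun g hg c hc ↦ by
    simpa using h.2 (P.normalizerMonoidHom ⟨g, hg⟩) ⟨c, h.1 hc⟩ hc

lemma exists_mulEquiv_map {P : Subgroup G} {f : G →* G'} (hf : ∀ x ∈ P, f x = 1 → x = 1) :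
    ∃ e : P ≃* P.map f, ∀ x, (e x : G') = f x :=
  ⟨MulEquiv.ofBijective (f.subgroupMap P) ⟨(injective_iff_map_eq_one _).mpr fun x hx ↦
    Subtype.ext (hf x x.2 (congr_arg Subtype.val hx)), f.subgroupMap_surjective P⟩, fun _ ↦ rfl⟩

lemma IsCharIn.map {C P : Subgroup G} (h : IsCharIn C P) {f : G →* G'}
    (hf : ∀ x ∈ P, f x = 1 → x = 1) : IsCharIn (C.map f) (P.map f) := by
  obtain ⟨e, he⟩ := exists_mulEquiv_map hf
  refine ⟨map_mono h.1, fun φ x hx ↦ ?_⟩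
  obtain ⟨c, hc, hcx⟩ := hx
  have hx : x = e ⟨c, h.1 hc⟩ := Subtype.ext (by rw [he, ← hcx])
  refine ⟨_, h.2 ((e.trans φ).trans e.symm) ⟨c, h.1 hc⟩ hc, ?_⟩
  rw [← he, hx]
  simp

lemma IsCharIn.exists_map_eq {P : Subgroup G} {f : G →* G'} (hf : ∀ x ∈ P, f x = 1 → x = 1)
    {C' : Subgroup G'} (h : IsCharIn C' (P.map f)) : ∃ C, IsCharIn C P ∧ C.map f = C' := by
  obtain ⟨e, he⟩ := exists_mulEquiv_map hf
  refine ⟨P ⊓ C'.comap f, ⟨inf_le_left, fun φ x hx ↦ ⟨(φ x).2, ?_⟩⟩, ?_⟩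
  · have h1 := h.2 ((e.symm.trans φ).trans e) (e x) (by rw [he]; exact hx.2)
    simpa [he] using h1
  · refine le_antisymm (map_le_iff_le_comap.mpr inf_le_right) fun y hy ↦ ?_
    obtain ⟨x, hx, rfl⟩ := h.1 hy
    exact ⟨x, ⟨hx, hy⟩, rfl⟩

/-- The elements of order dividing `p` of the center of `P`. -/
def omegaCenter (p : ℕ) (P : Subgroup G) : Subgroup G where
  carrier := {z | z ∈ P ∧ (∀ x ∈ P, x * z = z * x) ∧ z ^ p = 1}
  one_mem' := ⟨one_mem _, by simp, one_pow _⟩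
  mul_mem' := fun {a b} ha hb ↦ ⟨mul_mem ha.1 hb.1, fun x hx ↦ by
    rw [← mul_assoc, ha.2.1 x hx, mul_assoc, hb.2.1 x hx, mul_assoc],
    by rw [Commute.mul_pow (hb.2.1 a ha.1), ha.2.2, hb.2.2, one_mul]⟩
  inv_mem' := fun {a} ha ↦ ⟨inv_mem ha.1, fun x hx ↦ by
    have : Commute x a := ha.2.1 x hx
    exact this.inv_right.eq, by rw [inv_pow, ha.2.2, inv_one]⟩

lemma isCharIn_omegaCenter (p : ℕ) (P : Subgroup G) : IsCharIn (omegaCenter p P) P := by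
  refine ⟨fun z hz ↦ hz.1, fun φ z hz ↦ ⟨(φ z).2, fun x hx ↦ ?_, ?_⟩⟩
  · have h1 : φ.symm ⟨x, hx⟩ * z = z * φ.symm ⟨x, hx⟩ := Subtype.ext (hz.2.1 _ (Subtype.prop _))
    have h2 := congr_arg φ h1
    simp only [map_mul, MulEquiv.apply_symm_apply] at h2
    exact congr_arg Subtype.val h2
  · have h1 : z ^ p = 1 := Subtype.ext hz.2.2
    have h2 := congr_arg φ h1
    rw [map_pow, map_one] at h2
    exact congr_arg Subtype.val h2

lemma omegaCenter_ne_bot [Finite G] [Fact p.Prime] {P : Subgroup G} (hP : IsPGroup p P)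
    (h : P ≠ ⊥) : omegaCenter p P ≠ ⊥ := by
  have : Nontrivial P := (nontrivial_iff_ne_bot P).mpr h
  have hZ := hP.center_nontrivial
  have hd : p ∣ Nat.card (center P) := by
    by_contra hd
    exact (nontrivial_iff_ne_bot _).mp hZ ((hP.to_subgroup _).eq_bot_of_not_dvd hd)
  obtain ⟨z, hz⟩ := exists_prime_orderOf_dvd_card' p hd
  have hz1 : ((z : P) : G) ∈ omegaCenter p P := by
    refine ⟨z.1.2, fun x hx ↦ ?_, ?_⟩
    · exact congr_arg Subtype.val (mem_center_iff.mp z.2 ⟨x, hx⟩)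
    · have := pow_orderOf_eq_one z
      rw [hz] at this
      exact congr_arg (fun y : center P ↦ ((y : P) : G)) this
  intro he
  rw [he, mem_bot] at hz1
  have : z = 1 := Subtype.ext (Subtype.ext hz1)
  rw [this, orderOf_one] at hz
  exact (Fact.out : p.Prime).one_lt.ne hz

/-- `A` is an abelian subgroup of `P` of maximal order. -/
def IsMaxAbelianIn (A P : Subgroup G) : Prop :=
  (A ≤ P ∧ ∀ a ∈ A, ∀ b ∈ A, a * b = b * a) ∧
    ∀ B : Subgroup G, B ≤ P → (∀ a ∈ B, ∀ b ∈ B, a * b = b * a) → Nat.card B ≤ Nat.card A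

/-- The Thompson subgroup of `P`, generated by the abelian subgroups of `P` of maximal order. -/
def thompsonSubgroup (P : Subgroup G) : Subgroup G := sSup {A | IsMaxAbelianIn A P}

lemma IsMaxAbelianIn.le_thompsonSubgroup {A P : Subgroup G} (hA : IsMaxAbelianIn A P) :
    A ≤ thompsonSubgroup P := le_sSup (show A ∈ {A | IsMaxAbelianIn A P} from hA)

lemma exists_isMaxAbelianIn [Finite G] (P : Subgroup G) : ∃ A, IsMaxAbelianIn A P := by
  obtain ⟨A, hA, hmax⟩ := (Set.toFinite
    {A : Subgroup G | A ≤ P ∧ ∀ a ∈ A, ∀ b ∈ A, a * b = b * a}).exists_maximalFor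
    (fun A : Subgroup G ↦ Nat.card A) _ ⟨⊥, bot_le, by simp⟩
  exact ⟨A, hA, fun B hB hB' ↦ (le_total _ _).elim id fun h ↦ hmax ⟨hB, hB'⟩ h⟩

lemma isCharIn_thompsonSubgroup (P : Subgroup G) : IsCharIn (thompsonSubgroup P) P := by
  refine ⟨sSup_le fun A hA ↦ hA.1.1, fun φ x hx ↦ ?_⟩
  have h1 : thompsonSubgroup P ≤
      (((thompsonSubgroup P).subgroupOf P).comap φ.toMonoidHom).map P.subtype := by
    refine sSup_le fun A hA a ha ↦ ⟨⟨a, hA.1.1 ha⟩, ?_, rfl⟩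
    have hm : IsMaxAbelianIn (((A.subgroupOf P).map φ.toMonoidHom).map P.subtype) P := ?_
    · exact hm.le_thompsonSubgroup ⟨_, ⟨_, ha, rfl⟩, rfl⟩
    refine ⟨⟨map_subtype_le _, ?_⟩, fun B hB hB' ↦ (hA.2 B hB hB').trans ?_⟩
    · rintro _ ⟨_, ⟨b, hb, rfl⟩, rfl⟩ _ ⟨_, ⟨c, hc, rfl⟩, rfl⟩
      have : b * c = c * b := Subtype.ext (hA.1.2 b hb c hc)
      rw [← map_mul, ← map_mul, this, map_mul, map_mul]
    · rw [card_map_of_injective P.subtype_injective, card_map_of_injective φ.injective,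
        Nat.card_congr (subgroupOfEquivOfLe hA.1.1).toEquiv]
  obtain ⟨y, hy, hyx⟩ := h1 hx
  rwa [← Subtype.ext hyx]

lemma thompsonSubgroup_eq_of_le [Finite G] {P Q : Subgroup G} (hQP : Q ≤ P)
    (h : thompsonSubgroup P ≤ Q) : thompsonSubgroup Q = thompsonSubgroup P := by
  have hle (A : Subgroup G) (hA : IsMaxAbelianIn A P) : A ≤ Q := hA.le_thompsonSubgroup.trans h
  obtain ⟨A', hA'⟩ := exists_isMaxAbelianIn P
  unfold thompsonSubgroup
  congr 1
  ext A
  exact ⟨fun hA ↦ ⟨⟨hA.1.1.trans hQP, hA.1.2⟩, fun B hB hB' ↦ (hA'.2 B hB hB').trans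
      (hA.2 A' (hle A' hA') hA'.1.2)⟩,
    fun hA ↦ ⟨⟨hle A hA, hA.1.2⟩, fun B hB hB' ↦ hA.2 B (hB.trans hQP) hB'⟩⟩

lemma thompsonSubgroup_ne_bot [Finite G] [Fact p.Prime] {P : Subgroup G} (hP : IsPGroup p P)
    (h : P ≠ ⊥) : thompsonSubgroup P ≠ ⊥ := by
  obtain ⟨A, hA⟩ := exists_isMaxAbelianIn P
  intro he
  have hA' : A = ⊥ := le_bot_iff.mp (he ▸ hA.le_thompsonSubgroup)
  have h1 := hA.2 (omegaCenter p P) (fun z hz ↦ hz.1) fun a ha b hb ↦ hb.2.1 a ha.1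
  rw [hA', card_bot] at h1
  exact omegaCenter_ne_bot hP h (eq_bot_of_card_le _ h1)

end Characteristic

section Hypothesis

open Pointwise

variable {p : ℕ} {G : Type*} [Group G]

/-- The hypothesis of Thompson's normal `p`-complement theorem. -/
def ThompsonHypothesis (p : ℕ) (G : Type*) [Group G] : Prop :=
  ∀ (P : Sylow p G) (C : Subgroup G), C ≠ ⊥ → IsCharIn C P →
    HasNormalPComplement p (normalizer (C : Set G))

lemma HasNormalPComplement.normalizer_of_map_subtype [Finite G] [Fact p.Prime] {H : Subgroup G}
    {D : Subgroup H}
    (h : HasNormalPComplement p (normalizer (D.map H.subtype : Set G))) :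
    HasNormalPComplement p (normalizer (D : Set H)) := by
  refine h.of_injective ((H.subtype.comp (normalizer (D : Set H)).subtype).codRestrict _
    fun x ↦ le_normalizer_map H.subtype ⟨x, x.2, rfl⟩) ?_
  intro a b hab
  have hab' := Subtype.ext_iff.mp hab
  exact Subtype.ext (Subtype.ext hab')

lemma ThompsonHypothesis.normalizer_of_map_eq_sylow [Finite G] [Fact p.Prime]
    (h : ThompsonHypothesis p G) {H : Subgroup G} {S C : Subgroup H} (hC : IsCharIn C S)
    (hC' : C ≠ ⊥) {Q : Sylow p G} (hQ : S.map H.subtype = Q) :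
    HasNormalPComplement p (normalizer (C : Set H)) := by
  apply HasNormalPComplement.normalizer_of_map_subtype
  refine h Q _ ((map_eq_bot_iff_of_injective _ H.subtype_injective).not.mpr hC') ?_
  rw [← hQ]
  exact hC.map fun x _ hx ↦ Subtype.ext hx

lemma ThompsonHypothesis.of_sylow_le [Finite G] [hp : Fact p.Prime] (h : ThompsonHypothesis p G)
    {H : Subgroup G} (P : Sylow p G) (hP : P ≤ H) : ThompsonHypothesis p H := fun S C hC hCS ↦ by
  have h1 : ¬ p ∣ ((S : Subgroup H).map H.subtype).index := by
    rw [index_map_subtype, hp.out.dvd_mul, not_or]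
    exact ⟨S.not_dvd_index, fun h ↦ P.not_dvd_index (h.trans (index_dvd_of_le hP))⟩
  exact h.normalizer_of_map_eq_sylow hCS hC (Q := (S.2.map H.subtype).toSylow h1) rfl

lemma IsPGroup.exists_conj_eq_of_not_dvd_relIndex [Finite G] [Fact p.Prime] {A B M : Subgroup G}
    (hA : IsPGroup p A) (hB : IsPGroup p B) (hAM : A ≤ M) (hBM : B ≤ M)
    (hAi : ¬ p ∣ A.relIndex M) (hBi : ¬ p ∣ B.relIndex M) :
    ∃ m ∈ M, ∀ x, x ∈ A ↔ m * x * m⁻¹ ∈ B := by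
  obtain ⟨m, hm⟩ := MulAction.exists_smul_eq M (hA.comap_subtype.toSylow hAi)
    (hB.comap_subtype.toSylow hBi)
  have hm' : ((m • hA.comap_subtype.toSylow hAi : Sylow p M) : Subgroup M) = B.subgroupOf M :=
    congr_arg _ hm
  rw [Sylow.coe_subgroup_smul] at hm'
  have key (y : M) : (y : G) ∈ A ↔ (m * y * m⁻¹ : G) ∈ B := by
    have h1 : m * y * m⁻¹ ∈ B.subgroupOf M ↔ (y : G) ∈ A := by
      rw [← hm', ← MulAut.conj_apply, ← MulAut.smul_def, smul_mem_pointwise_smul_iff]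
      rfl
    rw [← h1]
    rfl
  refine ⟨m, m.2, fun x ↦ ⟨fun hx ↦ (key ⟨x, hAM hx⟩).mp hx, fun hx ↦ ?_⟩⟩
  have hxM : x ∈ M := by
    have := mul_mem (mul_mem (inv_mem m.2) (hBM hx)) m.2
    simpa [mul_assoc] using this
  exact (key ⟨x, hxM⟩).mpr hx

/-- The image under a homomorphism with `p'`-kernel of the normalizer of a `p`-subgroup is the
normalizer of the image. -/
lemma normalizer_map_le_map_normalizer {G' : Type*} [Group G'] [Finite G] [Fact p.Prime]
    {f : G →* G'} (hf : Function.Surjective f)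
    (hker : ¬ p ∣ Nat.card f.ker) {D : Subgroup G} (hD : IsPGroup p D) :
    normalizer (D.map f : Set G') ≤ (normalizer (D : Set G)).map f := by
  intro y hy
  obtain ⟨g, rfl⟩ := hf y
  set M := (D.map f).comap f
  have hDM : D ≤ M := le_comap_map f D
  have hgM (x : G) : x ∈ M ↔ g * x * g⁻¹ ∈ M := by
    have := mem_normalizer_iff.mp hy (f x)
    simpa [M] using this
  have hDi : ¬ p ∣ D.relIndex M := by
    have hM : M = D ⊔ f.ker := comap_map_eq f D
    intro hd
    apply hker
    have h1 : D.relIndex M * Nat.card D = f.ker.relIndex M * Nat.card f.ker := by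
      have := relIndex_mul_relIndex ⊥ D M bot_le hDM
      have := relIndex_mul_relIndex ⊥ f.ker M bot_le (hM ▸ le_sup_right)
      simp only [relIndex_bot_left] at *
      linarith
    have h2 : f.ker.relIndex M = Nat.card D := by
      rw [hM, relIndex_sup_right, relIndex_ker]
      refine Nat.card_congr (Equiv.ofBijective (f.subgroupMap D)
        ⟨?_, f.subgroupMap_surjective D⟩).symm
      refine (injective_iff_map_eq_one _).mpr fun x hx ↦ Subtype.ext ?_
      have h3 := inf_eq_bot_of_not_dvd_of_isPGroup hker hD
      exact (mem_bot.mp (h3.le ⟨congr_arg Subtype.val hx, x.2⟩))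
    rw [h2, mul_comm] at h1
    rwa [← Nat.eq_of_mul_eq_mul_left Nat.card_pos h1]
  have hDg : IsPGroup p (D.map (MulAut.conj g).toMonoidHom) := hD.map _
  have hDgM : D.map (MulAut.conj g).toMonoidHom ≤ M := by
    rintro _ ⟨x, hx, rfl⟩
    exact (hgM x).mp (hDM hx)
  have hMg : M.map (MulAut.conj g).toMonoidHom = M := by
    refine le_antisymm ?_ fun x hx ↦ ⟨g⁻¹ * x * g, ?_, by simp [mul_assoc]⟩
    · rintro _ ⟨x, hx, rfl⟩
      exact (hgM x).mp hx
    · exact (hgM _).mpr (by simpa [mul_assoc] using hx)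
  have hDgi : ¬ p ∣ (D.map (MulAut.conj g).toMonoidHom).relIndex M := by
    rwa [← hMg, relIndex_map_map_of_injective _ _ (MulAut.conj g).injective]
  obtain ⟨m, hm, h⟩ := hDg.exists_conj_eq_of_not_dvd_relIndex hD hDgM hDM hDgi hDi
  have h1 : m * g ∈ normalizer (D : Set G) := by
    rw [mem_normalizer_iff]
    intro x
    have h2 : x ∈ D ↔ g * x * g⁻¹ ∈ D.map (MulAut.conj g).toMonoidHom := by
      constructor
      · exact fun hx ↦ ⟨x, hx, rfl⟩
      · rintro ⟨y, hy, hyx⟩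
        have : y = x := (MulAut.conj g).injective hyx
        exact this ▸ hy
    rw [h2, h, show m * (g * x * g⁻¹) * m⁻¹ = m * g * x * (m * g)⁻¹ by group]
  have h3 : f m ∈ (normalizer (D : Set G)).map f := map_mono le_normalizer hm
  have h4 := mul_mem (inv_mem h3) (mem_map_of_mem f h1)
  simpa using h4

lemma ThompsonHypothesis.quotient [Finite G] [Fact p.Prime] (h : ThompsonHypothesis p G)
    {N : Subgroup G} [N.Normal] (hN : ¬ p ∣ Nat.card N) : ThompsonHypothesis p (G ⧸ N) := by
  intro P' C' hC' hCP'
  obtain ⟨P, rfl⟩ := Sylow.mapSurjective_surjective (QuotientGroup.mk'_surjective N) p P'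
  have hker : ¬ p ∣ Nat.card (QuotientGroup.mk' N).ker := by rwa [QuotientGroup.ker_mk']
  have hP : ∀ x ∈ (P : Subgroup G), QuotientGroup.mk' N x = 1 → x = 1 := fun x hx hx1 ↦
    mem_bot.mp ((inf_eq_bot_of_not_dvd_of_isPGroup hker P.2).le ⟨hx1, hx⟩)
  rw [Sylow.coe_mapSurjective] at hCP'
  obtain ⟨C, hC, rfl⟩ := hCP'.exists_map_eq hP
  have hC1 : C ≠ ⊥ := by
    rintro rfl
    exact hC' (by simp)
  have h1 := h P C hC1 hC
  refine HasNormalPComplement.mono (normalizer_map_le_map_normalizer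
    (QuotientGroup.mk'_surjective N) hker (P.2.to_le hC.1)) ?_
  exact h1.of_surjective ((QuotientGroup.mk' N).subgroupMap _)
    ((QuotientGroup.mk' N).subgroupMap_surjective _)

end Hypothesis

section Reduction

variable {p : ℕ} {G : Type u} [Group G]

lemma natCard_lt_of_lt [Finite G] {A B : Subgroup G} (h : A < B) : Nat.card A < Nat.card B :=
  Set.Finite.card_lt_card (Set.toFinite (B : Set G)) h

lemma IsPGroup.card_le_of_le [Finite G] [Fact p.Prime] {T N : Subgroup G} (hT : IsPGroup p T)
    (hTN : T ≤ N) (S : Sylow p N) : Nat.card T ≤ Nat.card S := by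
  obtain ⟨S', hS'⟩ := (hT.comap_subtype (K := N)).exists_le_sylow
  rw [S.card_eq_multiplicity, ← S'.card_eq_multiplicity,
    ← Nat.card_congr (subgroupOfEquivOfLe hTN).toEquiv]
  exact Subgroup.card_le_of_le hS'

/-- A group satisfying the hypothesis of Thompson's theorem inductively, but not its conclusion,
has a nontrivial normal `p`-subgroup. -/
lemma ThompsonHypothesis.exists_normal_isPGroup [Finite G] [Fact p.Prime]
    (h : ThompsonHypothesis p G)
    (ih : ∀ H : Subgroup G, H ≠ ⊤ → ThompsonHypothesis p H → HasNormalPComplement p H)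
    (hG : ¬ HasNormalPComplement p G) :
    ∃ X : Subgroup G, X.Normal ∧ IsPGroup p X ∧ X ≠ ⊥ := by
  have hF : ∃ X : Subgroup G, (X ≠ ⊥ ∧ IsPGroup p X) ∧
      ¬ HasNormalPComplement p (normalizer (X : Set G)) := by
    by_contra! hF
    exact hG (hasNormalPComplement_of_normalizer fun X hX hXp ↦ hF X ⟨hX, hXp⟩)
  obtain ⟨X, ⟨⟨hX, hXp⟩, hXN⟩, hmax⟩ := (Set.toFinite {X : Subgroup G | (X ≠ ⊥ ∧ IsPGroup p X) ∧
    ¬ HasNormalPComplement p (normalizer (X : Set G))}).exists_maximalFor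
    (fun X : Subgroup G ↦ Nat.card (default : Sylow p (normalizer (X : Set G)))) _ hF
  set N := normalizer (X : Set G) with hN
  by_cases hNt : N = ⊤
  · exact ⟨X, normalizer_eq_top_iff.mp hNt, hXp, hX⟩
  refine absurd (ih N hNt fun S C hC hCS ↦ ?_) hXN
  by_contra hCN
  set D := C.map N.subtype with hD
  have hDp : IsPGroup p D := (S.2.to_le hCS.1).map N.subtype
  have hD1 : D ≠ ⊥ := (map_eq_bot_iff_of_injective _ N.subtype_injective).not.mpr hC
  have hDN : ¬ HasNormalPComplement p (normalizer (D : Set G)) :=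
    fun hDN ↦ hCN hDN.normalizer_of_map_subtype
  set T := (S : Subgroup N).map N.subtype with hT
  have hTp : IsPGroup p T := S.2.map N.subtype
  have hDT : IsCharIn D T := hCS.map fun x _ hx ↦ Subtype.ext hx
  obtain ⟨P, hTP⟩ := hTp.exists_le_sylow
  rcases hTP.eq_or_lt with heq | hlt
  · exact hCN (h.normalizer_of_map_eq_sylow hCS hC heq)
  have h1 := P.2.lt_normalizer_inf hlt
  have h2 : Nat.card T < Nat.card (normalizer (T : Set G) ⊓ P : Subgroup G) :=
    natCard_lt_of_lt h1
  have h3 : Nat.card T = Nat.card (default : Sylow p N) := by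
    rw [hT, card_map_of_injective N.subtype_injective, S.card_eq_multiplicity,
      Sylow.card_eq_multiplicity]
  have h4 := (P.2.to_le inf_le_right).card_le_of_le (inf_le_left.trans hDT.normalizer_le)
    (default : Sylow p (normalizer (D : Set G)))
  have h5 := hmax (j := D) ⟨⟨hD1, hDp⟩, hDN⟩
  beta_reduce at h5
  rw [← h3] at h5
  exact absurd (h2.trans_le h4) (not_lt.mpr (h5 (h2.trans_le h4).le))

/-- If `X` is the largest normal `p`-subgroup, there is no nontrivial normal `p'`-subgroup, and
`K / X` is a normal `p`-complement of `G / X`, then `X` contains its centralizer. -/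
lemma centralizer_le_of_forall_normal [Finite G] [hp : Fact p.Prime] {X K : Subgroup G}
    [hXn : X.Normal] (hX : IsPGroup p X) (hmax : ∀ Y : Subgroup G, Y.Normal → IsPGroup p Y → Y ≤ X)
    (hO : ∀ N : Subgroup G, N.Normal → ¬ p ∣ Nat.card N → N = ⊥)
    (hK : K.Normal) (hKX : ¬ p ∣ X.relIndex K) (hKp : ∀ g : G, ∃ n : ℕ, g ^ p ^ n ∈ K) :
    centralizer (X : Set G) ≤ X := by
  set E := centralizer (X : Set G) ⊓ K with hE
  have hEn : E.Normal := inferInstance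
  have hZp : IsPGroup p (X.subgroupOf E) := hX.comap_subtype
  have hZi : ¬ p ∣ (X.subgroupOf E).index := fun hd ↦ hKX (hd.trans (by
    have h1 (H : Subgroup G) : X.relIndex H = Nat.card (H.map (QuotientGroup.mk' X)) := by
      rw [← relIndex_ker, QuotientGroup.ker_mk']
    change X.relIndex E ∣ _
    rw [h1, h1]
    exact card_dvd_of_le (map_mono inf_le_right)))
  have hEp : HasNormalPComplement p E := by
    obtain ⟨n, hn⟩ := IsPGroup.iff_card.mp hZp
    obtain ⟨L, hL⟩ := exists_right_complement'_of_coprime (N := X.subgroupOf E) (by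
      rw [hn]
      exact ((hp.out.coprime_iff_not_dvd).mpr hZi).pow_left n)
    have hcomm : ∀ z ∈ X.subgroupOf E, ∀ e : E, Commute z e := fun z hz e ↦
      Subtype.ext (e.2.1 _ hz)
    have hmul (e : E) : ∃ z ∈ X.subgroupOf E, ∃ l ∈ L, z * l = e := by
      obtain ⟨⟨z, l⟩, h⟩ := hL.2 e
      exact ⟨z, z.2, l, l.2, h⟩
    refine ⟨L, ⟨fun l hl e ↦ ?_⟩, ?_, fun e ↦ ?_⟩
    · obtain ⟨z, hz, m, hm, rfl⟩ := hmul e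
      have h1 : z * m * l * (z * m)⁻¹ = m * l * m⁻¹ := by
        have := (hcomm z hz (m * l * m⁻¹)).eq
        calc _ = z * (m * l * m⁻¹) * z⁻¹ := by group
          _ = _ := by rw [this, mul_inv_cancel_right]
      rw [h1]
      exact mul_mem (mul_mem hm hl) (inv_mem hm)
    · rwa [← hL.symm.index_eq_card] at *
    · obtain ⟨z, hz, l, hl, rfl⟩ := hmul e
      obtain ⟨n, hn⟩ := hZp ⟨z, hz⟩
      have hn' : z ^ p ^ n = 1 := congr_arg Subtype.val hn
      exact ⟨n, by rw [(hcomm z hz l).mul_pow, hn', one_mul]; exact pow_mem hl _⟩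
  obtain ⟨L, hLn, -, hLc, hLp⟩ := hEp.exists_normal_le hEn
  have hEX : E ≤ X := hmax E hEn fun e ↦ by
    obtain ⟨n, hn⟩ := hLp e e.2
    rw [hO L hLn hLc, mem_bot] at hn
    exact ⟨n, Subtype.ext (by simpa using hn)⟩
  refine hmax _ inferInstance fun g ↦ ?_
  obtain ⟨n, hn⟩ := hKp g
  obtain ⟨m, hm⟩ := hX ⟨_, hEX ⟨pow_mem g.2 _, hn⟩⟩
  refine ⟨n + m, Subtype.ext ?_⟩
  have hm' : ((g : G) ^ p ^ n) ^ p ^ m = 1 := congr_arg Subtype.val hm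
  rw [SubmonoidClass.coe_pow, pow_add, pow_mul, hm', OneMemClass.coe_one]

end Reduction

section Maximal

variable {p : ℕ} {G : Type u} [Group G]

lemma Subgroup.mem_of_pow_mem_of_coprime {X : Subgroup G} {x : G} {m n : ℕ} (hmn : m.Coprime n)
    (hm : x ^ m ∈ X) (hn : x ^ n ∈ X) : x ∈ X := by
  have h := Nat.gcd_eq_gcd_ab m n
  rw [hmn.gcd_eq_one] at h
  have h1 : x = (x ^ m) ^ m.gcdA n * (x ^ n) ^ m.gcdB n := by
    rw [← zpow_natCast, ← zpow_natCast, ← zpow_mul, ← zpow_mul, ← zpow_add, ← h]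
    simp
  rw [h1]
  exact mul_mem (zpow_mem hm _) (zpow_mem hn _)

lemma Subgroup.pow_relIndex_mem_of_normal {X K : Subgroup G} [X.Normal] {k : G} (hk : k ∈ K) :
    k ^ X.relIndex K ∈ X :=
  (X.subgroupOf K).pow_index_mem ⟨k, hk⟩

lemma inf_le_of_not_dvd_relIndex [hp : Fact p.Prime] {X K P : Subgroup G}
    [X.Normal] (hP : IsPGroup p P) (hKX : ¬ p ∣ X.relIndex K) : K ⊓ P ≤ X := by
  rintro x ⟨hxK, hxP⟩
  obtain ⟨n, hn⟩ := hP ⟨x, hxP⟩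
  have hn' : x ^ p ^ n = 1 := congr_arg Subtype.val hn
  exact mem_of_pow_mem_of_coprime (((hp.out.coprime_iff_not_dvd).mpr hKX).symm.pow_right n)
    (pow_relIndex_mem_of_normal hxK) (hn' ▸ one_mem X)

lemma eq_of_sup_eq_top {X K P W : Subgroup G} (hKP : K ⊓ P ≤ X) (hXW : X ≤ W) (hWK : W ≤ K)
    (hPW : P ≤ normalizer (W : Set G)) (h : P ⊔ W = ⊤) : W = K := by
  refine le_antisymm hWK fun k hk ↦ ?_
  have h1 : k ∈ ((P ⊔ W : Subgroup G) : Set G) := h ▸ Subgroup.mem_top k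
  rw [coe_mul_of_left_le_normalizer_right P W hPW] at h1
  obtain ⟨x, hx, w, hw, rfl⟩ := h1
  exact mul_mem (hXW (hKP ⟨(mul_mem_cancel_right (hWK hw)).mp hk, hx⟩)) hw

lemma eq_of_hasNormalPComplement_of_centralizer_le [Fact p.Prime] {X H : Subgroup G}
    [X.Normal] (hX : IsPGroup p X) (hC : centralizer (X : Set G) ≤ X) (P : Sylow p G)
    (hPH : P ≤ H) (hXH : X ≤ H) (h : HasNormalPComplement p H) : H = P := by
  obtain ⟨K, hK, hKc, hKp⟩ := h
  have hKX : K ≤ X.subgroupOf H := fun k hk ↦ hC fun x hx ↦ by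
    have := commute_of_disjoint_of_normal hK (inferInstance : (X.subgroupOf H).Normal)
      (inf_eq_bot_of_not_dvd_of_isPGroup hKc hX.comap_subtype) hk (b := ⟨x, hXH hx⟩) hx
    exact (congr_arg Subtype.val this).symm
  have hK1 : K = ⊥ := (hX.comap_subtype.to_le hKX).eq_bot_of_not_dvd hKc
  refine P.3 (fun g ↦ ?_) hPH
  obtain ⟨n, hn⟩ := hKp g
  exact ⟨n, by rwa [hK1, mem_bot] at hn⟩

/-- A `p`-group acting by conjugation on a normal `p'`-subgroup normalizes one of its
Sylow `q`-subgroups. -/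
lemma IsPGroup.exists_sylow_le_normalizer [Finite G] [Fact p.Prime] {R N : Subgroup G} [N.Normal]
    (hR : IsPGroup p R) (hN : ¬ p ∣ Nat.card N) (q : ℕ) [Fact q.Prime] :
    ∃ Q : Sylow q N, R ≤ normalizer ((Q : Subgroup N).map N.subtype : Set G) := by
  let φ : R →* MulAut N := MulAut.conjNormal.comp R.subtype
  let := MulAction.compHom (Sylow q N) φ
  have hc : ¬ p ∣ Nat.card (Sylow q N) := fun h ↦ by
    have Q : Sylow q N := default
    exact hN (h.trans (Q.card_dvd_index.trans (index_dvd_card _)))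
  obtain ⟨Q, hQ⟩ := hR.nonempty_fixed_point_of_prime_not_dvd_card (Sylow q N) hc
  refine ⟨Q, le_normalizer_iff.mpr ?_⟩
  rintro r hr _ ⟨y, hy, rfl⟩
  have h1 : φ ⟨r, hr⟩ • Q = Q := hQ ⟨r, hr⟩
  refine ⟨MulAut.conjNormal r y, ?_, by simp⟩
  rw [← h1]
  exact ⟨y, hy, rfl⟩

lemma commutator_le_of_forall_eq_or_eq_top [Finite G] [hp : Fact p.Prime] {X K : Subgroup G}
    [X.Normal] [K.Normal] (P : Sylow p G) (hXK : X ≤ K)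
    (hKX : ¬ p ∣ X.relIndex K) (hmax : ∀ H : Subgroup G, P ≤ H → H = P ∨ H = ⊤) :
    ⁅K, K⁆ ≤ X := by
  have hKP : K ⊓ P ≤ X := inf_le_of_not_dvd_relIndex P.2 hKX
  by_contra hcon
  have hlt : ¬ K ≤ X := fun h ↦ hcon ((commutator_le_left K K).trans h)
  set f := QuotientGroup.mk' X with hf
  have hfs : Function.Surjective f := QuotientGroup.mk'_surjective X
  have hfk : f.ker = X := QuotientGroup.ker_mk' X
  have hcard : X.relIndex K = Nat.card (K.map f) := by rw [← relIndex_ker, hfk]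
  have hKn : (K.map f).Normal := ‹K.Normal›.map f hfs
  obtain ⟨q, hq, hqd⟩ := Nat.exists_prime_and_dvd (n := Nat.card (K.map f)) (by
    rw [← hcard]
    exact fun h ↦ hlt (relIndex_eq_one.mp h))
  have : Fact q.Prime := ⟨hq⟩
  obtain ⟨Q, hQ⟩ := (P.2.map f).exists_sylow_le_normalizer (N := K.map f) (hcard ▸ hKX) q
  set Q' := (Q : Subgroup (K.map f)).map (K.map f).subtype
  have hQK : Q' ≤ K.map f := map_subtype_le _
  have hXW : X ≤ Q'.comap f := hfk.ge.trans (f.ker_le_comap Q')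
  have hWK : Q'.comap f ≤ K := (comap_mono hQK).trans (by
    rw [comap_map_eq, hfk, sup_eq_left.mpr hXK])
  have hPW : P ≤ normalizer (Q'.comap f : Set G) :=
    (map_le_iff_le_comap.mp hQ).trans (le_normalizer_comap f)
  have hnt : Nontrivial (K.map f) := by
    rw [← Finite.one_lt_card_iff_nontrivial]
    exact hq.one_lt.trans_le (Nat.le_of_dvd Nat.card_pos hqd)
  rcases hmax (P ⊔ Q'.comap f) le_sup_left with h | h
  · have h1 : Q'.comap f ≤ X := (le_inf hWK (sup_eq_left.mp h)).trans hKP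
    have h2 : Q' = ⊥ := by
      rw [← map_comap_eq_self_of_surjective hfs Q', Subgroup.map_eq_bot_iff, hfk]
      exact h1
    exact Q.ne_bot_of_dvd_card hqd
      ((map_eq_bot_iff_of_injective _ (K.map f).subtype_injective).mp h2)
  · have h1 : Q'.comap f = K := eq_of_sup_eq_top hKP hXW hWK hPW h
    have h2 : (Q : Subgroup (K.map f)) = ⊤ := by
      rw [eq_top_iff]
      rintro z -
      obtain ⟨k, hk, hkz⟩ := mem_map.mp z.2
      obtain ⟨y, hy, hyk⟩ : f k ∈ Q' := h1.ge hk
      exact Subtype.ext (hyk.trans hkz) ▸ hy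
    have hQp := Q.2
    have : IsPGroup q (K.map f) := (h2 ▸ hQp).of_equiv topEquiv
    have := this.isNilpotent
    have hlt := Group.IsSolvable.commutator_lt_top_of_nontrivial (K.map f)
    rcases hmax (P ⊔ (⁅K, K⁆ ⊔ X)) le_sup_left with h | h
    · exact hcon (le_sup_left.trans ((le_inf (sup_le (commutator_le_left K K) hXK)
        (sup_eq_left.mp h)).trans hKP))
    · have h3 : ⁅K, K⁆ ⊔ X = K := eq_of_sup_eq_top hKP le_sup_right
        (sup_le (commutator_le_left K K) hXK) le_normalizer_of_normal h
      have h4 : ⁅K.map f, K.map f⁆ = K.map f := by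
        conv_rhs => rw [← h3]
        rw [Subgroup.map_sup, map_commutator, (Subgroup.map_eq_bot_iff X).mpr hfk.ge, sup_bot_eq]
      refine hlt.ne ?_
      rw [← map_subtype_commutator] at h4
      exact map_injective (K.map f).subtype_injective (by
        rw [h4, ← MonoidHom.range_eq_map, range_subtype])

end Maximal

section Action

variable {p : ℕ} {G : Type u} [Group G]

lemma Subgroup.relIndex_dvd_index_of_normal_right [Finite G] (H N : Subgroup G) [N.Normal] :
    H.relIndex N ∣ H.index := by
  have h1 := relIndex_mul_index (inf_le_right : H ⊓ N ≤ N)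
  rw [← relIndex_mul_index (inf_le_left : H ⊓ N ≤ H), inf_relIndex_right, inf_relIndex_left] at h1
  obtain ⟨c, hc⟩ := relIndex_dvd_index_of_normal N H
  have h2 : N.relIndex H ≠ 0 := index_ne_zero_of_finite
  refine ⟨c, Nat.eq_of_mul_eq_mul_left (Nat.pos_of_ne_zero h2) ?_⟩
  rw [← h1, hc]
  ring

lemma Sylow.inf_normal_or_sup_eq_top [Finite G] [Fact p.Prime] (P : Sylow p G)
    (hmax : ∀ H : Subgroup G, P ≤ H → H = P ∨ H = ⊤) (N : Subgroup G) [N.Normal] :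
    ((P : Subgroup G) ⊓ N).Normal ∨ (P : Subgroup G) ⊔ N = ⊤ := by
  have h1 : (P : Subgroup G) ≤ normalizer ((P ⊓ N : Subgroup G) : Set G) :=
    le_normalizer_iff.mpr fun h hh k hk ↦
      ⟨Subgroup.mul_mem _ (Subgroup.mul_mem _ hh hk.1) (Subgroup.inv_mem _ hh),
        ‹N.Normal›.conj_mem k hk.2 h⟩
  rcases hmax _ h1 with h | h
  · right
    have h2 : ¬ p ∣ ((P : Subgroup G).subgroupOf N).index := fun hd ↦
      P.not_dvd_index (Dvd.dvd.trans hd (relIndex_dvd_index_of_normal_right (P : Subgroup G) N))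
    have hPN : IsPGroup p ((P : Subgroup G).subgroupOf N) := P.2.comap_subtype
    obtain ⟨Q, hQ⟩ : ∃ Q : Sylow p N, (Q : Subgroup N) = (P : Subgroup G).subgroupOf N :=
      ⟨hPN.toSylow h2, rfl⟩
    have h3 := Sylow.normalizer_sup_eq_top Q
    rwa [hQ, subgroupOf_map_subtype, h] at h3
  · exact Or.inl (normalizer_eq_top_iff.mp h)

lemma exists_quadratic_of_le [Finite G] [Fact p.Prime] {V : Type*} [AddCommGroup V] [Finite V]
    (hV : (p : AddMonoid.End V) = 0) (σ : G →* AddMonoid.End V) {A : Subgroup G}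
    (hA : IsPGroup p A) (hAc : ∀ a ∈ A, ∀ b ∈ A, a * b = b * a) (hAσ : ¬ A ≤ σ.ker)
    (W : Set V) (hW : ∀ w ∈ W, ∀ a ∈ A, σ a w = w)
    (hcard : Nat.card (A ⊓ σ.ker : Subgroup G) * Nat.card V ≤ Nat.card A * Nat.card W) :
    ∃ a ∈ A, σ a ≠ 1 ∧ (σ a - 1) * (σ a - 1) = 0 := by
  let _ : CommGroup A := { (inferInstance : Group A) with
    mul_comm := fun a b ↦ Subtype.ext (hAc a a.2 b b.2) }
  let ρ : A →* AddMonoid.End V := σ.comp A.subtype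
  have hker : ρ.ker.map A.subtype = A ⊓ σ.ker := by
    rw [inf_comm]
    exact σ.ker.subgroupOf_map_subtype A
  have h1 : ρ.ker < ⊤ := lt_top_iff_ne_top.mpr fun h ↦ hAσ fun a ha ↦
    (h.ge (mem_top (⟨a, ha⟩ : A)) : _)
  obtain ⟨a, -, ha⟩ := exists_quadratic hA hV ⊤ h1 (by
    rw [← hker, card_map_of_injective A.subtype_injective] at hcard
    rw [card_top]
    refine hcard.trans (Nat.mul_le_mul_left _ (Nat.card_mono (Set.toFinite _) ?_))
    exact fun w hw a _ ↦ hW w hw a a.2)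
  exact ⟨a, a.2, ha⟩

lemma false_of_quadratic [Finite G] [hp : Fact p.Prime] (hp2 : p ≠ 2) {R : Type*} [Ring R]
    (hR : (p : R) = 0) (σ : G →* Rˣ) {X K : Subgroup G} [X.Normal] [hKn : K.Normal] (P : Sylow p G)
    (hXσ : X ≤ σ.ker) (hKX : ¬ p ∣ X.relIndex K) (hKc : ⁅K, K⁆ ≤ X) (hKP : K ⊔ P = ⊤)
    (hPσ : (P : Subgroup G) ⊔ σ.ker ≠ ⊤)
    (hL : ∀ N : Subgroup G, N.Normal → ((P : Subgroup G) ⊓ N).Normal ∨ (P : Subgroup G) ⊔ N = ⊤)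
    (hX : ∀ Y : Subgroup G, Y.Normal → IsPGroup p Y → Y ≤ X) {a : G} (haP : a ∈ P) (ha : σ a ≠ 1)
    (haq : ((σ a : R) - 1) * (σ a - 1) = 0) : False := by
  have hcomm : ∀ k ∈ K, ∀ l ∈ K, Commute (σ k) (σ l) := fun k hk l hl ↦ by
    have h := hXσ (hKc (commutator_mem_commutator hk hl))
    rw [MonoidHom.mem_ker, map_commutatorElement] at h
    exact commutatorElement_eq_one_iff_commute.mp h
  have hfix : ∀ k ∈ K, σ a * σ k * (σ a)⁻¹ = σ k := fun k hk ↦ by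
    have h1 : σ k ^ X.relIndex K = 1 := by
      rw [← map_pow]
      exact hXσ (pow_relIndex_mem_of_normal hk)
    have hm : 0 < X.relIndex K := Nat.pos_of_ne_zero fun h ↦ hKX (h ▸ dvd_zero p)
    have h2 : σ k ^ p ^ (X.relIndex K).totient = σ k := by
      have h3 := Nat.ModEq.pow_totient ((hp.out.coprime_iff_not_dvd).mpr hKX)
      conv_rhs => rw [← pow_one (σ k)]
      rw [pow_eq_pow_iff_modEq]
      exact h3.of_dvd (orderOf_dvd_of_pow_eq_one h1)
    refine Units.commute_of_commute_conj hp2 hR (σ a) (σ k) haq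
      (Nat.totient_pos.mpr hm).ne' h2 ?_ ?_
    · have := hcomm k hk _ (hKn.conj_mem k hk a)
      simpa using this
    · have := hcomm k hk _ (hKn.conj_mem _ (hKn.conj_mem k hk a) a)
      simpa using this
  let f := σ.rangeRestrict
  have hfs : Function.Surjective f := σ.rangeRestrict_surjective
  have hfk : f.ker = σ.ker := σ.ker_rangeRestrict
  have hKf : (K.map f).Normal := hKn.map f hfs
  let L := centralizer (K.map f : Set σ.range)
  have hLn : L.Normal := inferInstance
  have hN : ((P : Subgroup G).map f ⊓ L).Normal := by
    rw [← normalizer_eq_top_iff, eq_top_iff, ← map_top_of_surjective f hfs, ← hKP, Subgroup.map_sup]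
    refine sup_le (fun k hk ↦ ?_) ?_
    · refine (le_normalizer_iff.mpr fun h hh x hx ↦ ?_ : K.map f ≤ _) hk
      have : h * x = x * h := hx.2 h hh
      rwa [this, mul_inv_cancel_right]
    · exact le_normalizer_iff.mpr fun h hh k hk ↦
        ⟨Subgroup.mul_mem _ (Subgroup.mul_mem _ hh hk.1) (Subgroup.inv_mem _ hh),
          hLn.conj_mem k hk.2 h⟩
  rcases hL _ (hN.comap f) with h | h
  · refine ha (hXσ (hX _ h (P.2.to_le inf_le_left) ⟨haP, mem_map_of_mem f haP, ?_⟩))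
    rintro _ ⟨k, hk, rfl⟩
    exact Subtype.ext (mul_inv_eq_iff_eq_mul.mp (hfix k hk)).symm
  · refine hPσ (eq_top_iff.mpr (h.ge.trans (sup_le le_sup_left ?_)))
    rw [← hfk, ← comap_map_eq]
    exact comap_mono inf_le_left

end Action

section Contradiction

variable {p : ℕ} {G : Type u} [Group G]

lemma HasNormalPComplement.of_eq_top [Finite G] {H : Subgroup G} (h : HasNormalPComplement p H)
    (hH : H = ⊤) : HasNormalPComplement p G := by
  subst hH
  exact h.of_surjective (topEquiv : (⊤ : Subgroup G) ≃* G).toMonoidHom topEquiv.surjective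

lemma AddMonoid.End.natCast_eq_zero {V : Type*} [AddCommGroup V] {n : ℕ}
    (h : ∀ v : V, n • v = 0) : (n : AddMonoid.End V) = 0 := by
  ext v
  simp [h]

lemma Subgroup.card_sup_mul_card_inf [Finite G] (A V : Subgroup G) [V.Normal] :
    Nat.card (A ⊔ V : Subgroup G) * Nat.card (A ⊓ V : Subgroup G) = Nat.card A * Nat.card V := by
  have h1 := relIndex_mul_relIndex ⊥ V (A ⊔ V) bot_le le_sup_right
  have h2 := relIndex_mul_relIndex ⊥ (A ⊓ V) A bot_le inf_le_left
  rw [relIndex_sup_right] at h1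
  rw [inf_relIndex_left] at h2
  simp only [relIndex_bot_left] at h1 h2
  rw [← h1, ← h2]
  ring

lemma omegaCenter_comm {X : Subgroup G} {a b : G} (ha : a ∈ omegaCenter p X)
    (hb : b ∈ omegaCenter p X) : a * b = b * a :=
  hb.2.1 a ha.1

lemma IsMaxAbelianIn.card_inf_centralizer_mul_le [Finite G] {A P V : Subgroup G} [V.Normal]
    (hA : IsMaxAbelianIn A P) (hVP : V ≤ P) (hV : ∀ a ∈ V, ∀ b ∈ V, a * b = b * a) :
    Nat.card (A ⊓ centralizer (V : Set G) : Subgroup G) * Nat.card V ≤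
      Nat.card A * Nat.card (A ⊓ centralizer (V : Set G) ⊓ V : Subgroup G) := by
  rw [← card_sup_mul_card_inf]
  refine Nat.mul_le_mul_right _ (hA.2 _ (sup_le (inf_le_left.trans hA.1.1) hVP) ?_)
  have h1 : A ⊓ centralizer (V : Set G) ⊔ V ≤
      centralizer ((A ⊓ centralizer (V : Set G) ⊔ V : Subgroup G) : Set G) := by
    refine sup_le ?_ ?_ <;> rw [le_centralizer_iff] <;> refine sup_le ?_ ?_
    · exact fun x hx y hy ↦ hA.1.2 y hy.1 x hx.1
    · exact fun x hx y hy ↦ (hy.2 x hx).symm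
    · exact fun x hx y hy ↦ hx.2 y hy
    · exact fun x hx y hy ↦ hV y hy x hx
  exact fun a ha b hb ↦ h1 hb a ha

lemma Sylow.sup_ne_top_of_not_le [Finite G] [hp : Fact p.Prime] (P : Sylow p G) {X K C : Subgroup G}
    [X.Normal] [C.Normal] (hXC : X ≤ C) (hKX : ¬ p ∣ X.relIndex K) (hKC : ¬ K ≤ C) :
    (P : Subgroup G) ⊔ C ≠ ⊤ := by
  refine fun h ↦ hKC fun k hk ↦ ?_
  obtain ⟨x, hx, c, hc, rfl⟩ := mem_sup_of_normal_right.mp (h ▸ mem_top k)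
  obtain ⟨n, hn⟩ := P.2 ⟨x, hx⟩
  have hn' : x ^ p ^ n = 1 := congr_arg Subtype.val hn
  refine mem_of_pow_mem_of_coprime (((hp.out.coprime_iff_not_dvd).mpr hKX).pow_left n) ?_
    (hXC (pow_relIndex_mem_of_normal hk))
  rw [← QuotientGroup.eq_one_iff, QuotientGroup.mk_pow, QuotientGroup.mk_mul,
    (QuotientGroup.eq_one_iff c).mpr hc, mul_one, ← QuotientGroup.mk_pow, hn', QuotientGroup.mk_one]

lemma ThompsonHypothesis.exists_isMaxAbelianIn_not_le [Finite G] [Fact p.Prime]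
    (h : ThompsonHypothesis p G) (hG : ¬ HasNormalPComplement p G) (P : Sylow p G)
    (hP : (P : Subgroup G) ≠ ⊥)
    (hmax : ∀ H : Subgroup G, P ≤ H → H = P ∨ H = ⊤) {C : Subgroup G} [C.Normal]
    (hPC : (P : Subgroup G) ⊔ C ≠ ⊤) : ∃ A, IsMaxAbelianIn A P ∧ ¬ A ≤ C := by
  by_contra! hA
  have h1 : thompsonSubgroup (P : Subgroup G) ≤ (P : Subgroup G) ⊓ C :=
    sSup_le fun A hAP ↦ le_inf hAP.1.1 (hA A hAP)
  rcases P.inf_normal_or_sup_eq_top hmax C with h2 | h2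
  · refine hG ((h P _ (thompsonSubgroup_ne_bot P.2 hP)
      (isCharIn_thompsonSubgroup _)).of_eq_top (eq_top_iff.mpr ?_))
    rw [← thompsonSubgroup_eq_of_le inf_le_left h1, ← normalizer_eq_top_iff.mpr h2]
    exact (isCharIn_thompsonSubgroup _).normalizer_le
  · exact hPC h2

lemma ThompsonHypothesis.hasNormalPComplement_of_centralizer_le [Finite G] [hp : Fact p.Prime]
    (hp2 : p ≠ 2) (h : ThompsonHypothesis p G) (P : Sylow p G) {X K : Subgroup G} [hXn : X.Normal]
    [K.Normal] (hX : ∀ Y : Subgroup G, Y.Normal → IsPGroup p Y → Y ≤ X) (hXP : X ≤ P) (hXK : X ≤ K)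
    (hC : centralizer (X : Set G) ≤ X) (hKX : ¬ p ∣ X.relIndex K)
    (hKp : ∀ g : G, ∃ n, g ^ p ^ n ∈ K)
    (hmax : ∀ H : Subgroup G, P ≤ H → H = P ∨ H = ⊤) : HasNormalPComplement p G := by
  by_contra hG
  have hKP : K ⊔ P = ⊤ := P.sup_eq_top_of_forall_pow_mem hKp
  have hKc : ⁅K, K⁆ ≤ X := commutator_le_of_forall_eq_or_eq_top P hXK hKX hmax
  have hP : (P : Subgroup G) ≠ ⊥ := fun hP ↦ by
    refine hG ⟨⊤, inferInstance, ?_, fun g ↦ ⟨0, mem_top _⟩⟩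
    rw [card_top, ← index_bot, ← hP]
    exact P.not_dvd_index
  set V := omegaCenter p X with hV
  have hVn : V.Normal := normalizer_eq_top_iff.mp <| eq_top_iff.mpr <|
    (normalizer_eq_top_iff.mpr hXn).ge.trans (isCharIn_omegaCenter p X).normalizer_le
  have hVX : V ≤ X := (isCharIn_omegaCenter p X).1
  have hVc : ∀ a ∈ V, ∀ b ∈ V, a * b = b * a := fun a ha b hb ↦ omegaCenter_comm ha hb
  set C := centralizer (V : Set G) with hCV
  have hXC : X ≤ C := fun x hx v hv ↦ (hv.2.1 x hx).symm
  have hZV : omegaCenter p (P : Subgroup G) ≤ V := fun z hz ↦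
    ⟨hC fun x hx ↦ hz.2.1 x (hXP hx), fun x hx ↦ hz.2.1 x (hXP hx), hz.2.2⟩
  have hKC : ¬ K ≤ C := fun hKC ↦ by
    refine hG ((h P _ (omegaCenter_ne_bot P.2 hP) (isCharIn_omegaCenter p _)).of_eq_top
      (eq_top_iff.mpr (hKP.ge.trans (sup_le ?_ ?_))))
    · refine le_normalizer_iff.mpr fun k hk z hz ↦ ?_
      rwa [← hKC hk z (hZV hz), mul_inv_cancel_right]
    · exact le_normalizer.trans (isCharIn_omegaCenter p _).normalizer_le
  have hPC : (P : Subgroup G) ⊔ C ≠ ⊤ := P.sup_ne_top_of_not_le hXC hKX hKC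
  obtain ⟨A, hA, hAC⟩ := h.exists_isMaxAbelianIn_not_le hG P hP hmax hPC
  let _ : CommGroup V := { (inferInstance : Group V) with
    mul_comm := fun a b ↦ Subtype.ext (hVc a a.2 b b.2) }
  let σ : G →* AddMonoid.End (Additive V) :=
    { toFun := fun g ↦ (MulAut.conjNormal g : V ≃* V).toMonoidHom.toAdditive
      map_one' := by rw [map_one]; rfl
      map_mul' := fun g g' ↦ by rw [map_mul]; rfl }
  have hσ : ∀ g (v : V), σ g (Additive.ofMul v) = Additive.ofMul (MulAut.conjNormal g v) :=
    fun _ _ ↦ rfl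
  have hfix : ∀ g (v : V), σ g (Additive.ofMul v) = Additive.ofMul v ↔ (v : G) * g = g * v := by
    intro g v
    rw [hσ, Additive.ofMul.injective.eq_iff, Subtype.ext_iff, MulAut.conjNormal_apply,
      mul_inv_eq_iff_eq_mul, eq_comm]
  have hker : σ.ker = C := by
    ext g
    refine ⟨fun hg v hv ↦ (hfix g ⟨v, hv⟩).mp ?_, fun hg ↦ ?_⟩
    · rw [MonoidHom.mem_ker.mp hg]
      rfl
    · exact AddMonoidHom.ext fun v ↦ (hfix g v.toMul).mpr (hg _ v.toMul.2)
  have hV0 : (p : AddMonoid.End (Additive V)) = 0 :=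
    AddMonoid.End.natCast_eq_zero fun v ↦ Subtype.ext v.toMul.2.2.2
  have hkerA : Nat.card (A ⊓ σ.ker : Subgroup G) * Nat.card (Additive V) ≤
      Nat.card A * Nat.card (Additive.toMul ⁻¹' {v : V | (v : G) ∈ A}) := by
    rw [hker]
    refine (hA.card_inf_centralizer_mul_le (hVX.trans hXP) hVc).trans (Nat.mul_le_mul_left _ ?_)
    refine Nat.card_le_card_of_injective
      (fun v ↦ ⟨Additive.ofMul ⟨v, v.2.2⟩, v.2.1.1⟩) fun v w hvw ↦ ?_
    have h1 := Additive.ofMul.injective (Subtype.ext_iff.mp hvw : Additive.ofMul (_ : V) = _)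
    exact Subtype.ext (Subtype.ext_iff.mp h1 :)
  obtain ⟨a, haA, ha1, haq⟩ := exists_quadratic_of_le hV0 σ (P.2.to_le hA.1.1) hA.1.2
    (hker ▸ hAC) (Additive.toMul ⁻¹' {v : V | (v : G) ∈ A})
    (fun w hw a ha ↦ (hfix a w.toMul).mpr (hA.1.2 _ hw a ha)) hkerA
  have hker' : σ.toHomUnits.ker = C := by
    rw [← hker]
    ext g
    simp [MonoidHom.mem_ker]
  exact false_of_quadratic hp2 hV0 σ.toHomUnits P (hXC.trans hker'.ge) hKX hKc hKP
    (hker'.symm ▸ hPC) (fun N _ ↦ P.inf_normal_or_sup_eq_top hmax N) hX (hA.1.1 haA)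
    (fun h ↦ ha1 (congr_arg Units.val h)) haq

end Contradiction

section Thompson

variable {p : ℕ}

lemma ThompsonHypothesis.quotient_of_forall_normal {G : Type u} [Group G] [Finite G]
    [hp : Fact p.Prime] (h : ThompsonHypothesis p G)
    (ih : ∀ H : Subgroup G, H ≠ ⊤ → ThompsonHypothesis p H → HasNormalPComplement p H)
    {X : Subgroup G} [X.Normal] (hXp : IsPGroup p X)
    (hX : ∀ Y : Subgroup G, Y.Normal → IsPGroup p Y → Y ≤ X) : ThompsonHypothesis p (G ⧸ X) := by
  intro P' C hC hCP
  obtain ⟨P, rfl⟩ := Sylow.mapSurjective_surjective (QuotientGroup.mk'_surjective X) p P'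
  set f := QuotientGroup.mk' X with hf
  have hfs : Function.Surjective f := QuotientGroup.mk'_surjective X
  have hfk : f.ker = X := QuotientGroup.ker_mk' X
  have hDC : (C.comap f).map f = C := map_comap_eq_self_of_surjective hfs C
  have hD : IsPGroup p (C.comap f) :=
    ((Sylow.isPGroup' _).to_le hCP.1).comap_of_ker_isPGroup f (hfk.symm ▸ hXp)
  have hPD : (P : Subgroup G) ≤ normalizer (C.comap f : Set G) := by
    refine (map_le_iff_le_comap.mp ?_).trans (le_normalizer_comap f)
    rw [Sylow.coe_mapSurjective] at hCP
    exact le_normalizer.trans hCP.normalizer_le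
  have hne : normalizer (C.comap f : Set G) ≠ ⊤ := fun hn ↦ by
    refine hC (eq_bot_iff.mpr ?_)
    rw [← hDC, map_le_iff_le_comap]
    exact (hX _ (normalizer_eq_top_iff.mp hn) hD).trans hfk.ge
  have h1 := ih _ hne (h.of_sylow_le P hPD)
  have h2 : (normalizer (C : Set (G ⧸ X))).comap f = normalizer (C.comap f : Set G) :=
    comap_normalizer_eq_of_surjective C hfs
  rw [← h2] at h1
  exact h1.of_surjective (f.subgroupComap _) (f.subgroupComap_surjective_of_surjective _ hfs)

/-- **Thompson's normal `p`-complement theorem**: if `p` is odd and the normalizer of every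
nontrivial characteristic subgroup of a Sylow `p`-subgroup has a normal `p`-complement, then the
group has a normal `p`-complement. -/
theorem ThompsonHypothesis.hasNormalPComplement {G : Type u} [Group G] [Finite G]
    [hp : Fact p.Prime] (h : ThompsonHypothesis p G) (hp2 : p ≠ 2) : HasNormalPComplement p G := by
  induction hn : Nat.card G using Nat.strong_induction_on generalizing G with | _ n ih
  subst hn
  have ihH : ∀ H : Subgroup G, H ≠ ⊤ → ThompsonHypothesis p H → HasNormalPComplement p H :=
    fun H hH hTH ↦ ih _ ((natCard_lt_of_lt (lt_top_iff_ne_top.mpr hH)).trans_eq card_top) hTH rfl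
  have ihQ : ∀ (N : Subgroup G) [N.Normal], N ≠ ⊥ → ThompsonHypothesis p (G ⧸ N) →
      HasNormalPComplement p (G ⧸ N) := fun N _ hN hTH ↦ by
    refine ih _ ?_ hTH rfl
    rw [← index_eq_card, ← N.card_mul_index]
    exact lt_mul_of_one_lt_left (Nat.pos_of_ne_zero index_ne_zero_of_finite)
      (N.one_lt_card_iff_ne_bot.mpr hN)
  by_contra hG
  have hO : ∀ N : Subgroup G, N.Normal → ¬ p ∣ Nat.card N → N = ⊥ := fun N _ hNp ↦ by
    by_contra hN
    exact hG ((ihQ N hN (h.quotient hNp)).of_quotient hNp)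
  obtain ⟨X₀, hX₀n, hX₀p, hX₀⟩ := h.exists_normal_isPGroup ihH hG
  obtain ⟨X, ⟨hXn, hXp⟩, hXm⟩ :=
    (Set.toFinite {X : Subgroup G | X.Normal ∧ IsPGroup p X}).exists_maximal ⟨X₀, hX₀n, hX₀p⟩
  have hX : ∀ Y : Subgroup G, Y.Normal → IsPGroup p Y → Y ≤ X := fun Y hY hYp ↦
    le_sup_right.trans (hXm ⟨sup_normal X Y, hXp.to_sup_of_normal_left hYp⟩ le_sup_left)
  have hX1 : X ≠ ⊥ := fun h1 ↦ hX₀ (le_bot_iff.mp (h1 ▸ hX X₀ hX₀n hX₀p))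
  obtain ⟨P, hXP⟩ := hXp.exists_le_sylow
  set f := QuotientGroup.mk' X with hf
  have hfs : Function.Surjective f := QuotientGroup.mk'_surjective X
  have hfk : f.ker = X := QuotientGroup.ker_mk' X
  obtain ⟨K, hKn, hKc, hKp⟩ := ihQ X hX1 (h.quotient_of_forall_normal ihH hXp hX)
  have hKX : ¬ p ∣ X.relIndex (K.comap f) := by
    have h1 := relIndex_ker (K.comap f) f
    rw [map_comap_eq_self_of_surjective hfs, hfk] at h1
    rwa [h1]
  have hKp' : ∀ g : G, ∃ n, g ^ p ^ n ∈ K.comap f := fun g ↦ by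
    obtain ⟨n, hn⟩ := hKp (f g)
    exact ⟨n, by rwa [mem_comap, map_pow]⟩
  have hC := centralizer_le_of_forall_normal hXp hX hO (hKn.comap f) hKX hKp'
  refine hG (h.hasNormalPComplement_of_centralizer_le hp2 P (K := K.comap f) hX hXP
    (hfk.ge.trans (f.ker_le_comap K)) hC hKX hKp' fun H hPH ↦ ?_)
  by_cases hH : H = ⊤
  · exact Or.inr hH
  · exact Or.inl (eq_of_hasNormalPComplement_of_centralizer_le hXp hC P hPH (hXP.trans hPH)
      (ihH H hH (h.of_sylow_le P hPH)))

end Thompson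

section Supplements

variable {G : Type u} [Group G]

lemma Subgroup.isNilpotent_of_le {H K : Subgroup G} (hHK : H ≤ K) (hK : Group.IsNilpotent K) :
    Group.IsNilpotent H :=
  Group.nilpotent_of_mulEquiv (subgroupOfEquivOfLe hHK)

lemma sInf_coatoms_not_isNilpotent_normal :
    (sInf {M : Subgroup G | IsCoatom M ∧ ¬ Group.IsNilpotent M}).Normal := by
  refine ⟨fun n hn g ↦ mem_sInf.mpr fun M hM ↦ ?_⟩
  refine mem_sInf.mp hn (M.comap (MulAut.conj g).toMonoidHom)
    ⟨((MulAut.conj g).comapSubgroup.isCoatom_iff M).mpr hM.1, fun h ↦ hM.2 ?_⟩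
  exact Group.nilpotent_of_surjective ((MulAut.conj g).toMonoidHom.subgroupComap M)
    (MonoidHom.subgroupComap_surjective_of_surjective _ M (MulAut.conj g).surjective)

lemma isSolvable_of_forall_normal_eq_or_eq [Finite G] {D : Subgroup G} [D.Normal]
    (hD : ∀ H : Subgroup G, H ≠ ⊤ → H ⊔ D = ⊤ → Group.IsNilpotent H)
    (hmin : ∀ N : Subgroup G, N.Normal → N ≤ D → N = ⊥ ∨ N = D) : Group.IsSolvable D := by
  by_cases h2 : ∀ q, q.Prime → q ∣ Nat.card D → q = 2
  · have hD2 : IsPGroup 2 D := IsPGroup.of_card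
      (Nat.eq_prime_pow_of_unique_prime_dvd Nat.card_pos.ne' fun hq hqd ↦ h2 _ hq hqd)
    have : Fact (Nat.Prime 2) := ⟨Nat.prime_two⟩
    have := hD2.isNilpotent
    infer_instance
  push Not at h2
  obtain ⟨p, hp, hpD, hp2⟩ := h2
  have : Fact p.Prime := ⟨hp⟩
  have hTH : ThompsonHypothesis p D := by
    intro P C hC hCP
    have hN : normalizer (C.map D.subtype : Set G) ⊔ D = ⊤ := by
      refine eq_top_iff.mpr ((Sylow.normalizer_sup_eq_top P).ge.trans (sup_le_sup_right ?_ D))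
      exact (hCP.map fun x _ hx ↦ D.subtype_injective (hx.trans (map_one _).symm)).normalizer_le
    by_cases h : normalizer (C.map D.subtype : Set G) = ⊤
    · have hCD : C.map D.subtype = D := (hmin _ (normalizer_eq_top_iff.mp h)
        (map_subtype_le C)).resolve_left
          ((map_eq_bot_iff_of_injective _ D.subtype_injective).not.mpr hC)
      have hC1 : C = ⊤ := map_injective D.subtype_injective (by
        rw [hCD, ← MonoidHom.range_eq_map, range_subtype])
      have := (P.2.to_le (hC1.ge.trans hCP.1) : IsPGroup p (⊤ : Subgroup D)).isNilpotent
      rw [hC1, normalizer_eq_top_iff.mpr inferInstance]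
      exact Group.IsNilpotent.hasNormalPComplement
    · have := hD _ h hN
      exact (Group.IsNilpotent.hasNormalPComplement (p := p)).normalizer_of_map_subtype
  obtain ⟨K, hK, hKD, hKp, hDK⟩ := (hTH.hasNormalPComplement hp2).exists_normal_le ‹D.Normal›
  rcases hmin K hK hKD with rfl | rfl
  · have hDp : IsPGroup p D := fun g ↦ by
      obtain ⟨n, hn⟩ := hDK g g.2
      exact ⟨n, Subtype.ext (mem_bot.mp hn)⟩
    have := hDp.isNilpotent
    infer_instance
  · exact absurd hpD hKp

/-- A normal subgroup all of whose proper supplements are nilpotent is solvable. -/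
theorem isSolvable_of_forall_sup_eq_top [Finite G] (D : Subgroup G) [D.Normal]
    (hD : ∀ H : Subgroup G, H ≠ ⊤ → H ⊔ D = ⊤ → Group.IsNilpotent H) : Group.IsSolvable D := by
  induction hn : Nat.card D using Nat.strong_induction_on generalizing G with | _ n ih
  subst hn
  by_cases hmin : ∀ N : Subgroup G, N.Normal → N ≤ D → N = ⊥ ∨ N = D
  · exact isSolvable_of_forall_normal_eq_or_eq hD hmin
  push Not at hmin
  obtain ⟨N, hN, hND, hN1, hN2⟩ := hmin
  set f := QuotientGroup.mk' N with hf
  have hfs : Function.Surjective f := QuotientGroup.mk'_surjective N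
  have hfk : f.ker = N := QuotientGroup.ker_mk' N
  have hNs : Group.IsSolvable N := ih _ (natCard_lt_of_lt (hND.lt_of_ne hN2)) N
    (fun H hH hHN ↦ hD H hH (eq_top_iff.mpr (hHN.ge.trans (sup_le_sup_left hND H)))) rfl
  have hDn : (D.map f).Normal := ‹D.Normal›.map f hfs
  have hcard : Nat.card (D.map f) < Nat.card D := by
    have h1 := relIndex_mul_relIndex ⊥ N D bot_le hND
    rw [relIndex_bot_left, relIndex_bot_left, ← hfk, relIndex_ker, hfk] at h1
    rw [← h1]
    exact lt_mul_of_one_lt_left Nat.card_pos (N.one_lt_card_iff_ne_bot.mpr hN1)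
  have hDs : Group.IsSolvable (D.map f) := ih _ hcard (D.map f) (fun H hH hHD ↦ by
    have hHf : (H.comap f).map f = H := map_comap_eq_self_of_surjective hfs H
    have := hD (H.comap f) (fun h ↦ hH (by rw [← hHf, h, map_top_of_surjective f hfs])) (by
      rw [← sup_eq_left.mpr (show f.ker ≤ H.comap f ⊔ D from (f.ker_le_comap H).trans le_sup_left),
        ← comap_map_eq, Subgroup.map_sup, hHf, hHD, comap_top])
    exact Group.nilpotent_of_surjective (f.subgroupComap H)
      (f.subgroupComap_surjective_of_surjective H hfs)) rfl
  refine Group.isSolvable_of_ker_le_range (inclusion hND) (f.subgroupMap D) fun d hd ↦ ?_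
  exact ⟨⟨d, hfk.le (congr_arg Subtype.val hd)⟩, rfl⟩

end Supplements

theorem stmt11 {G : Type*} [Group G] [Fintype G] (hG : ¬ IsSolvable G) :
    Group.IsNilpotent
      ↥(sInf {M : Subgroup G | IsCoatom M ∧ ¬ Group.IsNilpotent ↥M}) := by
  set D : Subgroup G := sInf {M : Subgroup G | IsCoatom M ∧ ¬ Group.IsNilpotent ↥M} with hD
  have hDn : D.Normal := sInf_coatoms_not_isNilpotent_normal
  have hsup : ∀ H : Subgroup G, H ≠ ⊤ → H ⊔ D = ⊤ → Group.IsNilpotent H := by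
    intro H hH hHD
    obtain ⟨M, hM, hHM⟩ := (eq_top_or_exists_le_coatom H).resolve_left hH
    have hMn : Group.IsNilpotent M := by
      by_contra hMn
      exact hM.1 (eq_top_iff.mpr (hHD.ge.trans (sup_le hHM (sInf_le ⟨hM, hMn⟩))))
    exact isNilpotent_of_le hHM hMn
  have hDs := isSolvable_of_forall_sup_eq_top D hsup
  by_cases h : ∃ H : Subgroup G, H ≠ ⊤ ∧ H ⊔ D = ⊤
  · obtain ⟨H, hH, hHD⟩ := h
    have := hsup H hH hHD
    have hGD : Group.IsSolvable (G ⧸ D) := by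
      refine Group.isSolvable_of_surjective (f := (QuotientGroup.mk' D).comp H.subtype) fun x ↦ ?_
      obtain ⟨g, rfl⟩ := QuotientGroup.mk'_surjective D x
      obtain ⟨k, hk, d, hd, rfl⟩ := mem_sup_of_normal_right.mp (hHD ▸ mem_top g)
      refine ⟨⟨k, hk⟩, ?_⟩
      simp [(QuotientGroup.eq_one_iff d).mpr hd]
    refine absurd (Group.isSolvable_of_ker_le_range D.subtype (QuotientGroup.mk' D) ?_) hG
    rw [QuotientGroup.ker_mk', range_subtype]
  · push Not at h
    have hDF : D ≤ frattini G := le_iInf₂ fun M hM ↦ by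
      by_contra hDM
      exact h M hM.1 (hM.2 _ (left_lt_sup.mpr hDM))
    exact isNilpotent_of_le hDF frattini_nilpotent
end

section
/- Let G be a finite non-solvable group. Then the intersection of all non-normal non-nilpotent maximal subgroups of G is nilpotent. -/
namespace Subgroup

variable {G : Type*} [Group G]

theorem isNilpotent_of_comap {H : Type*} [Group H] {f : G →* H} (hf : Function.Surjective f)
    {M : Subgroup H} (h : Group.IsNilpotent (M.comap f)) : Group.IsNilpotent M :=
  Group.nilpotent_of_surjective (f.subgroupComap M)
    (f.subgroupComap_surjective_of_surjective M hf)

theorem normal_of_comap {H : Type*} [Group H] {f : G →* H} (hf : Function.Surjective f)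
    {M : Subgroup H} (h : (M.comap f).Normal) : M.Normal :=
  map_comap_eq_self_of_surjective hf M ▸ h.map f hf

/-- Normalizers grow inside a nilpotent subgroup. -/
theorem exists_mem_normalizer_notMem {H K : Subgroup G} [Group.IsNilpotent K] (h : H < K) :
    ∃ x ∈ K, x ∉ H ∧ x ∈ normalizer (H : Set G) := by
  have hlt : H.subgroupOf K < ⊤ := by
    rw [lt_top_iff_ne_top, Ne, subgroupOf_eq_top]
    exact not_le_of_gt h
  obtain ⟨x, hx, hxH⟩ := SetLike.exists_of_lt (Group.normalizerCondition_of_isNilpotent _ hlt)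
  rw [mem_subgroupOf] at hxH
  refine ⟨x, x.2, hxH, ?_⟩
  rw [← subgroupOf_normalizer_eq h.le] at hx
  exact hx

/-- A coatom containing the normalizer of a Sylow subgroup is not normal. -/
theorem not_normal_of_normalizer_sylow_le [Finite G] {p : ℕ} [Fact p.Prime] (P : Sylow p G)
    {M : Subgroup G} (hM : IsCoatom M) (h : normalizer (P : Set G) ≤ M) : ¬ M.Normal := by
  intro _
  have := P.normalizer_sup_eq_top' (le_normalizer.trans h)
  exact hM.1 (by rwa [sup_eq_right.2 h] at this)

theorem _root_.Sylow.normalizer_injective [Finite G] {p : ℕ} [Fact p.Prime] {P Q : Sylow p G}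
    (h : normalizer (P : Set G) = normalizer (Q : Set G)) : P = Q := by
  have h1 := P.isPGroup'.inf_normalizer_sylow Q
  have h2 : (P : Subgroup G) ≤ normalizer (Q : Set G) := h ▸ le_normalizer
  have h3 : (P : Subgroup G) ≤ Q := by
    have : (P : Subgroup G) ⊓ normalizer (Q : Set G) = P := inf_eq_left.2 h2
    exact inf_eq_left.1 (h1.symm.trans this)
  exact Sylow.ext (P.is_maximal' Q.isPGroup' h3).symm

/-- In a simple group all of whose maximal subgroups are nilpotent, distinct maximal subgroups
intersect trivially. -/
theorem inf_eq_bot_of_isCoatom [Finite G] [IsSimpleGroup G]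
    (hnil : ∀ M : Subgroup G, IsCoatom M → Group.IsNilpotent M) {M₁ M₂ : Subgroup G}
    (h₁ : IsCoatom M₁) (h₂ : IsCoatom M₂) (hne : M₁ ≠ M₂) : M₁ ⊓ M₂ = ⊥ := by
  obtain ⟨I, hI⟩ : ∃ I, M₁ ⊓ M₂ = I := ⟨_, rfl⟩
  induction I using WellFoundedGT.induction generalizing M₁ M₂ with
  | ind I ih =>
    by_contra hbot
    rw [hI] at hbot
    have hN : normalizer (I : Set G) ≠ ⊤ := by
      intro h
      rcases (normalizer_eq_top_iff.1 h).eq_bot_or_eq_top with h | h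
      · exact hbot h
      · exact h₁.1 (top_le_iff.1 (by rw [← h, ← hI]; exact inf_le_left))
    obtain ⟨M₃, h₃, hle⟩ := (eq_top_or_exists_le_coatom _).resolve_left hN
    have key : ∀ M : Subgroup G, IsCoatom M → I < M → M = M₃ := by
      intro M hM hIM
      by_contra hne3
      have := hnil M hM
      obtain ⟨x, hxM, hxI, hx⟩ := exists_mem_normalizer_notMem hIM
      have hlt : I < M ⊓ M₃ :=
        lt_of_le_of_ne (le_inf hIM.le (le_normalizer.trans hle))
          fun h => hxI (h ▸ ⟨hxM, hle hx⟩)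
      have := ih _ hlt hM h₃ hne3 rfl
      exact not_lt_bot (this ▸ hlt)
    have l₁ : I < M₁ := by
      rw [← hI, inf_lt_left]
      exact fun h => hne (h₁.le_iff_eq h₂.1 |>.1 h).symm
    have l₂ : I < M₂ := by
      rw [← hI, inf_lt_right]
      exact fun h => hne (h₂.le_iff_eq h₁.1 |>.1 h)
    exact hne ((key M₁ h₁ l₁).trans (key M₂ h₂ l₂).symm)

theorem normalizer_ne_top_of_isPGroup [Finite G]
    (hsol : ∀ K : Subgroup G, K.Normal → Group.IsSolvable K → K = ⊥)
    {p : ℕ} [Fact p.Prime] {P : Subgroup G}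
    (hP : IsPGroup p P) (hne : P ≠ ⊥) : normalizer (P : Set G) ≠ ⊤ := by
  intro h
  have := hP.isNilpotent
  exact hne (hsol P (normalizer_eq_top_iff.1 h) inferInstance)

theorem isCoatom_normalizer_sylow [Finite G]
    (hsol : ∀ K : Subgroup G, K.Normal → Group.IsSolvable K → K = ⊥)
    (hnil : ∀ M : Subgroup G, IsCoatom M → ¬ M.Normal → Group.IsNilpotent M)
    {p : ℕ} [Fact p.Prime] (P : Sylow p G)
    (hp : p ∣ Nat.card G) :
    IsCoatom (normalizer (P : Set G)) ∧ Group.IsNilpotent (normalizer (P : Set G)) := by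
  have hN := normalizer_ne_top_of_isPGroup hsol P.isPGroup' (P.ne_bot_of_dvd_card hp)
  obtain ⟨M, hM, hle⟩ := (eq_top_or_exists_le_coatom _).resolve_left hN
  have hMnil := hnil M hM (not_normal_of_normalizer_sylow_le P hM hle)
  have hPM : (P : Subgroup G) ≤ M := le_normalizer.trans hle
  have hn : ((P.subtype hPM : Sylow p M) : Subgroup M).Normal := inferInstance
  rw [Sylow.coe_subtype] at hn
  have : M = normalizer (P : Set G) :=
    le_antisymm (le_normalizer_of_normal_subgroupOf hPM) hle
  exact this ▸ ⟨hM, hMnil⟩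

theorem exists_sylow_normalizer_eq [Finite G]
    (hsol : ∀ K : Subgroup G, K.Normal → Group.IsSolvable K → K = ⊥)
    {M : Subgroup G} (hM : IsCoatom M)
    [Group.IsNilpotent M] {r : ℕ} [Fact r.Prime] (hr : r ∣ Nat.card M) :
    ∃ R : Sylow r G, normalizer (R : Set G) = M := by
  obtain ⟨R₀⟩ : Nonempty (Sylow r M) := inferInstance
  obtain ⟨R, hR⟩ := R₀.exists_comap_subtype_eq
  have hn : (((R : Subgroup G) ⊓ M).subgroupOf M).Normal := by
    rw [inf_subgroupOf_right]
    have : (R : Subgroup G).subgroupOf M = R₀ := hR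
    rw [this]
    infer_instance
  have hne : (R : Subgroup G) ⊓ M ≠ ⊥ := by
    intro h
    apply R₀.ne_bot_of_dvd_card hr
    have : (R : Subgroup G).subgroupOf M = R₀ := hR
    rw [← this, ← inf_subgroupOf_right, h, bot_subgroupOf]
  have hN : normalizer (((R : Subgroup G) ⊓ M : Subgroup G) : Set G) = M := by
    have h := normalizer_ne_top_of_isPGroup hsol (R.isPGroup'.to_le inf_le_left) hne
    exact (hM.le_iff_eq h).1 (le_normalizer_of_normal_subgroupOf inf_le_right)
  have hRM : (R : Subgroup G) ≤ M := by
    by_contra h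
    have := R.isPGroup'.isNilpotent
    obtain ⟨x, hxR, hx, hxN⟩ := exists_mem_normalizer_notMem (inf_lt_left.2 h)
    exact hx ⟨hxR, hN ▸ hxN⟩
  refine ⟨R, ?_⟩
  rw [inf_eq_left.2 hRM] at hN
  exact hN

/-- The normalizers of suitable Sylow subgroups have coprime orders. -/
theorem exists_coprime_card_normalizer_sylow [Finite G]
    (hsol : ∀ K : Subgroup G, K.Normal → Group.IsSolvable K → K = ⊥)
    (hnil : ∀ M : Subgroup G, IsCoatom M → ¬ M.Normal → Group.IsNilpotent M)
    (hG : ¬ Group.IsSolvable G) :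
    ∃ p q : ℕ, p.Prime ∧ q.Prime ∧ p ∣ Nat.card G ∧ q ∣ Nat.card G ∧
      ∀ (P : Sylow p G) (Q : Sylow q G),
        (Nat.card (normalizer (P : Set G))).Coprime (Nat.card (normalizer (Q : Set G))) := by
  have h1 : Nat.card G ≠ 1 := by
    intro h
    have := (Nat.card_eq_one_iff_unique.1 h).1
    exact hG inferInstance
  have hp := Nat.minFac_prime h1
  have hpG := Nat.minFac_dvd (Nat.card G)
  generalize (Nat.card G).minFac = p at hp hpG
  have : Fact p.Prime := ⟨hp⟩
  obtain ⟨P₀⟩ : Nonempty (Sylow p G) := inferInstance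
  have hi : (normalizer (P₀ : Set G)).index ≠ 1 := by
    rw [Ne, index_eq_one]
    exact (isCoatom_normalizer_sylow hsol hnil P₀ hpG).1.1
  have hq := Nat.minFac_prime hi
  have hqi := Nat.minFac_dvd (normalizer (P₀ : Set G)).index
  generalize (normalizer (P₀ : Set G)).index.minFac = q at hq hqi
  have : Fact q.Prime := ⟨hq⟩
  have hqG : q ∣ Nat.card G := hqi.trans (index_dvd_card _)
  refine ⟨p, q, hp, hq, hpG, hqG, fun P Q => ?_⟩
  refine Nat.Coprime.symm (Nat.coprime_of_dvd fun r hr hrQ hrP => ?_)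
  have : Fact r.Prime := ⟨hr⟩
  rw [P₀.card_eq_index_normalizer.symm, P.card_eq_index_normalizer] at hqi
  obtain ⟨hPc, hPn⟩ := isCoatom_normalizer_sylow hsol hnil P hpG
  obtain ⟨hQc, hQn⟩ := isCoatom_normalizer_sylow hsol hnil Q hqG
  obtain ⟨R, hR⟩ := exists_sylow_normalizer_eq hsol hPc hrP
  obtain ⟨S, hS⟩ := exists_sylow_normalizer_eq hsol hQc hrQ
  rw [← hR, ← R.card_eq_index_normalizer, S.card_eq_index_normalizer, hS,
    ← Q.card_eq_index_normalizer] at hqi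
  exact not_dvd_card_sylow q G hqi

theorem isSimpleGroup_of_not_isSolvable [Finite G]
    (hsol : ∀ K : Subgroup G, K.Normal → Group.IsSolvable K → K = ⊥)
    (hnil : ∀ M : Subgroup G, IsCoatom M → ¬ M.Normal → Group.IsNilpotent M)
    (hG : ¬ Group.IsSolvable G) : IsSimpleGroup G := by
  have : Nontrivial G := by
    by_contra h
    have := not_nontrivial_iff_subsingleton.1 h
    exact hG inferInstance
  refine ⟨fun K hK => or_iff_not_imp_left.2 fun hbot => ?_⟩
  obtain ⟨p, q, hp, hq, hpG, hqG, hpq⟩ := exists_coprime_card_normalizer_sylow hsol hnil hG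
  have : Fact p.Prime := ⟨hp⟩
  have : Fact q.Prime := ⟨hq⟩
  have key : ∀ M : Subgroup G, IsCoatom M → Group.IsNilpotent M → K.index ∣ Nat.card M := by
    intro M hM hMn
    have hKM : ¬ K ≤ M := fun h =>
      hbot (hsol K hK (Group.isSolvable_of_isSolvable_injective (inclusion_injective h)))
    have htop : K ⊔ M = ⊤ := sup_comm M K ▸ hM.2 _ (left_lt_sup.2 hKM)
    have := relIndex_sup_right M K
    rw [sup_comm, htop, relIndex_top_right] at this
    rw [this]
    exact relIndex_dvd_card K M
  obtain ⟨P⟩ : Nonempty (Sylow p G) := inferInstance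
  obtain ⟨Q⟩ : Nonempty (Sylow q G) := inferInstance
  obtain ⟨hPc, hPn⟩ := isCoatom_normalizer_sylow hsol hnil P hpG
  obtain ⟨hQc, hQn⟩ := isCoatom_normalizer_sylow hsol hnil Q hqG
  exact index_eq_one.1 (Nat.eq_one_of_dvd_coprimes (hpq P Q) (key _ hPc hPn) (key _ hQc hQn))

/-- The number of pairs of a Sylow `p`-subgroup and a nontrivial element of its normalizer is at
least half the order of the group. -/
theorem card_le_two_mul_card_sigma_normalizer [Finite G] {p : ℕ} [Fact p.Prime]
    (hp : p ∣ Nat.card G) :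
    Nat.card G ≤
      2 * Nat.card (Σ P : Sylow p G, {x : normalizer (P : Set G) // x ≠ 1}) := by
  classical
  have := Fintype.ofFinite (Sylow p G)
  have hsum : Nat.card (Σ P : Sylow p G, {x : normalizer (P : Set G) // x ≠ 1}) +
      Nat.card (Sylow p G) = Nat.card G := by
    obtain ⟨P₀⟩ : Nonempty (Sylow p G) := inferInstance
    have hc : ∀ P : Sylow p G, Nat.card {x : normalizer (P : Set G) // x ≠ 1} + 1 =
        Nat.card (normalizer (P₀ : Set G)) := by
      intro P
      have h1 := card_mul_index (normalizer (P : Set G))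
      have h2 := card_mul_index (normalizer (P₀ : Set G))
      rw [← P.card_eq_index_normalizer] at h1
      rw [← P₀.card_eq_index_normalizer, ← h1] at h2
      rw [Nat.eq_of_mul_eq_mul_right Nat.card_pos h2]
      have := Fintype.ofFinite (normalizer (P : Set G))
      have := Fintype.card_subtype_compl (fun x : normalizer (P : Set G) => x = 1)
      have hpos : 0 < Fintype.card (normalizer (P : Set G)) := Fintype.card_pos
      simp only [Nat.card_eq_fintype_card]
      simp at this ⊢
      omega
    have hG := card_mul_index (normalizer (P₀ : Set G))
    rw [← P₀.card_eq_index_normalizer] at hG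
    rw [Nat.card_sigma, ← hG, Nat.card_eq_fintype_card (α := Sylow p G), mul_comm,
      ← smul_eq_mul, ← Finset.card_univ, ← Finset.sum_const, Finset.card_eq_sum_ones,
      ← Finset.sum_add_distrib]
    exact Finset.sum_congr rfl fun P _ => hc P
  have hle : 2 * Nat.card (Sylow p G) ≤ Nat.card G := by
    obtain ⟨P⟩ : Nonempty (Sylow p G) := inferInstance
    have h1 := card_mul_index (normalizer (P : Set G))
    rw [← P.card_eq_index_normalizer] at h1
    rw [← h1]
    refine Nat.mul_le_mul_right _ ?_
    have hd := (P.dvd_card_of_dvd_card hp).trans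
      (card_dvd_of_le (le_normalizer (H := (P : Subgroup G))))
    exact (Fact.out : p.Prime).two_le.trans (Nat.le_of_dvd Nat.card_pos hd)
  omega

theorem isSolvable_of_forall_isCoatom_of_forall_normal [Finite G]
    (hsol : ∀ K : Subgroup G, K.Normal → Group.IsSolvable K → K = ⊥)
    (hnil : ∀ M : Subgroup G, IsCoatom M → ¬ M.Normal → Group.IsNilpotent M) :
    Group.IsSolvable G := by
  by_contra hG
  have := isSimpleGroup_of_not_isSolvable hsol hnil hG
  have hall : ∀ M : Subgroup G, IsCoatom M → Group.IsNilpotent M := by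
    intro M hM
    by_cases h : M.Normal
    · obtain rfl := h.eq_bot_or_eq_top.resolve_right hM.1
      infer_instance
    · exact hnil M hM h
  obtain ⟨p, q, hp, hq, hpG, hqG, hpq⟩ := exists_coprime_card_normalizer_sylow hsol hnil hG
  have : Fact p.Prime := ⟨hp⟩
  have : Fact q.Prime := ⟨hq⟩
  let f : (Σ P : Sylow p G, {x : normalizer (P : Set G) // x ≠ 1}) ⊕
      (Σ Q : Sylow q G, {x : normalizer (Q : Set G) // x ≠ 1}) → {x : G // x ≠ 1} :=
    Sum.elim (fun s => ⟨s.2.1, by simpa using s.2.2⟩) (fun s => ⟨s.2.1, by simpa using s.2.2⟩)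
  have inj : ∀ (r : ℕ) [Fact r.Prime], r ∣ Nat.card G →
      ∀ a b : Σ P : Sylow r G, {x : normalizer (P : Set G) // x ≠ 1},
        (a.2.1 : G) = b.2.1 → a = b := by
    rintro r _ hr ⟨P, ⟨x, hx⟩, hx1⟩ ⟨Q, ⟨y, hy⟩, hy1⟩ hxy
    obtain rfl : x = y := hxy
    have hPQ : P = Q := by
      by_contra hne
      have := inf_eq_bot_of_isCoatom hall (isCoatom_normalizer_sylow hsol hnil P hr).1
        (isCoatom_normalizer_sylow hsol hnil Q hr).1 (mt Sylow.normalizer_injective hne)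
      have hx' : x ∈ (⊥ : Subgroup G) := this ▸ ⟨hx, hy⟩
      exact hx1 (Subtype.ext (mem_bot.1 hx'))
    subst hPQ
    rfl
  have disj : ∀ (a : Σ P : Sylow p G, {x : normalizer (P : Set G) // x ≠ 1})
      (b : Σ Q : Sylow q G, {x : normalizer (Q : Set G) // x ≠ 1}), (a.2.1 : G) ≠ b.2.1 := by
    rintro ⟨P, ⟨x, hx⟩, hx1⟩ ⟨Q, ⟨y, hy⟩, hy1⟩ hxy
    obtain rfl : x = y := hxy
    have hx' : x ∈ (⊥ : Subgroup G) := (disjoint_of_coprime_natCard (hpq P Q)).eq_bot ▸ ⟨hx, hy⟩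
    exact hx1 (Subtype.ext (mem_bot.1 hx'))
  have hf : Function.Injective f := by
    rintro (a | a) (b | b) hab
    · exact congrArg Sum.inl (inj p hpG a b (congrArg Subtype.val hab))
    · exact absurd (congrArg Subtype.val hab) (disj a b)
    · exact absurd (congrArg Subtype.val hab).symm (disj b a)
    · exact congrArg Sum.inr (inj q hqG a b (congrArg Subtype.val hab))
  have hcard := Nat.card_le_card_of_injective f hf
  rw [Nat.card_sum] at hcard
  have hlt : Nat.card {x : G // x ≠ 1} < Nat.card G :=
    Finite.card_subtype_lt (x := 1) (by simp)
  have := card_le_two_mul_card_sigma_normalizer hpG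
  have := card_le_two_mul_card_sigma_normalizer hqG
  omega

/-- A finite group all of whose non-normal maximal subgroups are nilpotent is solvable. -/
theorem isSolvable_of_forall_isCoatom_normal_or_isNilpotent {G : Type*} [Group G] [Finite G]
    (hnil : ∀ M : Subgroup G, IsCoatom M → ¬ M.Normal → Group.IsNilpotent M) :
    Group.IsSolvable G := by
  obtain ⟨n, hn⟩ : ∃ n, Nat.card G = n := ⟨_, rfl⟩
  induction n using Nat.strong_induction_on generalizing G with
  | _ n ih =>
    by_cases hsol : ∀ K : Subgroup G, K.Normal → Group.IsSolvable K → K = ⊥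
    · exact isSolvable_of_forall_isCoatom_of_forall_normal hsol hnil
    · push Not at hsol
      obtain ⟨K, hK, hKs, hKne⟩ := hsol
      have hlt : Nat.card (G ⧸ K) < n := by
        have h1 := card_eq_card_quotient_mul_card_subgroup K
        have h2 : 1 < Nat.card K := one_lt_card_iff_ne_bot _ |>.2 hKne
        have h3 : 0 < Nat.card (G ⧸ K) := Nat.card_pos
        rw [← hn, h1]
        nlinarith
      have hquot : Group.IsSolvable (G ⧸ K) := by
        refine ih _ hlt (fun M hM hMn => ?_) rfl
        have hsurj := QuotientGroup.mk'_surjective K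
        have := hnil (M.comap (QuotientGroup.mk' K)) (isCoatom_comap_of_surjective hsurj hM)
          fun h => hMn (normal_of_comap hsurj h)
        exact isNilpotent_of_comap hsurj this
      exact Group.isSolvable_of_ker_le_range K.subtype (QuotientGroup.mk' K) (by simp)

/-- The intersection of a conjugation-invariant set of subgroups is normal. -/
theorem sInf_normal_of_forall_comap_conj_mem {S : Set (Subgroup G)}
    (h : ∀ M ∈ S, ∀ g : G, M.comap (MulAut.conj g).toMonoidHom ∈ S) : (sInf S).Normal := by
  refine ⟨fun n hn g => mem_sInf.2 fun M hM => ?_⟩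
  simpa using mem_sInf.1 hn _ (h M hM g)

/-- A maximal subgroup containing a normal subgroup with nilpotent quotient is normal. -/
theorem normal_of_isCoatom_of_le [Finite G] {N M : Subgroup G} [N.Normal]
    [Group.IsNilpotent (G ⧸ N)] (hM : IsCoatom M) (h : N ≤ M) : M.Normal := by
  have hsurj := QuotientGroup.mk'_surjective N
  have hcomap : (M.map (QuotientGroup.mk' N)).comap (QuotientGroup.mk' N) = M :=
    comap_map_eq_self (by simpa using h)
  have hc : IsCoatom (M.map (QuotientGroup.mk' N)) := by
    refine ⟨fun ht => hM.1 ?_, fun K hK => ?_⟩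
    · rw [← hcomap, ht, comap_top]
    · have := hM.2 (K.comap (QuotientGroup.mk' N))
        (hcomap ▸ (comap_lt_comap_of_surjective hsurj).2 hK)
      rw [← map_comap_eq_self_of_surjective hsurj K, this, map_top_of_surjective _ hsurj]
  have := NormalizerCondition.normal_of_coatom _ Group.normalizerCondition_of_isNilpotent hc
  exact hcomap ▸ this.comap _

/-- If `N` is normal and not nilpotent, and every non-normal maximal subgroup not containing `N`
is nilpotent, then `G ⧸ N` is nilpotent. -/
theorem isNilpotent_quotient_of_not_isNilpotent [Finite G] (N : Subgroup G) [N.Normal]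
    (hN : ¬ Group.IsNilpotent N)
    (h : ∀ M : Subgroup G, IsCoatom M → ¬ M.Normal → ¬ N ≤ M → Group.IsNilpotent M) :
    Group.IsNilpotent (G ⧸ N) := by
  have hsyl := mt ((Group.isNilpotent_of_finite_tfae (G := N)).out 3 0).1 hN
  push Not at hsyl
  obtain ⟨p, hp, P, hP⟩ := hsyl
  obtain ⟨Q, hQ⟩ := P.exists_comap_subtype_eq
  have hPQ : (P : Subgroup N).map N.subtype = N ⊓ Q := by
    rw [← hQ, inf_comm, ← subgroupOf_map_subtype]
    rfl
  have hle : normalizer (Q : Set G) ≤ normalizer ((P : Subgroup N).map N.subtype : Set G) := by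
    rw [hPQ]
    exact (le_inf le_normalizer_of_normal le_rfl).trans inf_normalizer_le_normalizer_inf
  have hne : normalizer ((P : Subgroup N).map N.subtype : Set G) ≠ ⊤ := by
    intro ht
    have := (normalizer_eq_top_iff.1 ht).comap N.subtype
    exact hP (by rwa [comap_map_eq_self_of_injective N.subtype_injective] at this)
  obtain ⟨M, hM, hle'⟩ := (eq_top_or_exists_le_coatom _).resolve_left hne
  have hsup : M ⊔ N = ⊤ := top_le_iff.1 (P.normalizer_sup_eq_top ▸ sup_le_sup_right hle' N)
  have hNM : ¬ N ≤ M := fun hNM => hM.1 (by rwa [sup_eq_left.2 hNM] at hsup)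
  have := h M hM (not_normal_of_normalizer_sylow_le Q hM (hle.trans hle')) hNM
  refine Group.nilpotent_of_surjective ((QuotientGroup.mk' N).comp M.subtype) ?_
  have hmap := congrArg (map (QuotientGroup.mk' N)) hsup
  rw [map_sup, QuotientGroup.map_mk'_self, sup_bot_eq,
    map_top_of_surjective _ (QuotientGroup.mk'_surjective N)] at hmap
  rw [← MonoidHom.range_eq_top, MonoidHom.range_comp, range_subtype, hmap]

end Subgroup

open Subgroup in
theorem stmt12 {G : Type*} [Group G] [Fintype G] (hG : ¬ IsSolvable G) :
    Group.IsNilpotent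
      ↥(sInf {M : Subgroup G | IsCoatom M ∧ ¬ M.Normal ∧ ¬ Group.IsNilpotent ↥M}) := by
  set N : Subgroup G := sInf {M | IsCoatom M ∧ ¬ M.Normal ∧ ¬ Group.IsNilpotent M}
  by_contra hN
  have : N.Normal := sInf_normal_of_forall_comap_conj_mem fun M ⟨hM, hMn, hMnil⟩ g => by
    have hsurj : Function.Surjective (MulAut.conj g).toMonoidHom := (MulAut.conj g).surjective
    exact ⟨isCoatom_comap_of_surjective hsurj hM, fun h => hMn (normal_of_comap hsurj h),
      fun h => hMnil (isNilpotent_of_comap hsurj h)⟩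
  have hle (M : Subgroup G) (hM : IsCoatom M) (hMn : ¬ M.Normal) (hMnil : ¬ Group.IsNilpotent M) :
      N ≤ M := sInf_le ⟨hM, hMn, hMnil⟩
  have := isNilpotent_quotient_of_not_isNilpotent N hN fun M hM hMn hNM => by
    by_contra hMnil
    exact hNM (hle M hM hMn hMnil)
  refine hG (isSolvable_of_forall_isCoatom_normal_or_isNilpotent fun M hM hMn => ?_)
  by_contra hMnil
  exact hMn (normal_of_isCoatom_of_le hM (hle M hM hMn hMnil))
end

section
/- Let G be a finite non-solvable group. Then the intersection of all non-nilpotent maximal subgroups of G equals the Frattini subgroup of G. -/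
open Subgroup

universe u

/-- In a nilpotent subgroup `K`, normalizers grow. -/
theorem Subgroup.exists_mem_normalizer_of_lt_of_isNilpotent {G : Type*} [Group G]
    {H K : Subgroup G} [Group.IsNilpotent K] (h : H < K) :
    ∃ g ∈ K, g ∉ H ∧ g ∈ normalizer (H : Set G) := by
  have hlt : H.subgroupOf K < ⊤ := by
    rw [lt_top_iff_ne_top, Ne, subgroupOf_eq_top]
    exact h.not_ge
  have := Group.normalizerCondition_of_isNilpotent (G := K) _ hlt
  rw [← subgroupOf_normalizer_eq h.le] at this
  obtain ⟨g, hg, hg'⟩ := SetLike.exists_of_lt this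
  exact ⟨g, g.2, hg', hg⟩

/-- In a finite group without nontrivial solvable normal subgroups, a nilpotent maximal subgroup
is the normalizer of a Sylow `p`-subgroup for every prime `p` dividing its order. -/
theorem IsCoatom.exists_sylow_normalizer_eq {G : Type*} [Group G] [Finite G]
    (hS : ∀ N : Subgroup G, N.Normal → Group.IsSolvable N → N = ⊥)
    {M : Subgroup G} (hM : IsCoatom M) [Group.IsNilpotent M]
    {p : ℕ} [hp : Fact p.Prime] (hpM : p ∣ Nat.card M) :
    ∃ P : Sylow p G, normalizer (P : Set G) = M := by
  obtain ⟨Q⟩ : Nonempty (Sylow p M) := inferInstance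
  have hQn : (Q : Subgroup M).Normal :=
    ((Group.isNilpotent_of_finite_tfae (G := M)).out 0 3 :).mp ‹_› p hp Q
  set R : Subgroup G := (Q : Subgroup M).map M.subtype with hR
  have hRM : R ≤ M := map_subtype_le _
  have hRp : IsPGroup p R := Q.isPGroup'.map _
  have hRnil : Group.IsNilpotent R := hRp.isNilpotent
  have hRne : R ≠ ⊥ := by
    intro h
    have h1 : (Q : Subgroup M) = ⊥ := by
      rwa [hR, map_eq_bot_iff_of_injective _ M.subtype_injective] at h
    have h2 := Q.dvd_card_of_dvd_card hpM
    rw [h1, card_bot] at h2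
    exact hp.out.one_lt.ne' (Nat.dvd_one.mp h2)
  have hRnorm : normalizer (R : Set G) = M := by
    refine (hM.le_iff_eq fun h => hRne ?_).mp ?_
    · exact hS R (normalizer_eq_top_iff.mp h) inferInstance
    · rw [← normal_subgroupOf_iff_le_normalizer hRM, hR, subgroupOf,
        comap_map_eq_self_of_injective M.subtype_injective]
      exact hQn
  obtain ⟨P, hRP⟩ := hRp.exists_le_sylow
  suffices h : R = P by
    refine ⟨P, ?_⟩
    have h' : (R : Set G) = (P : Set G) := by rw [h]; rfl
    rw [← h', hRnorm]
  by_contra hne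
  have : Group.IsNilpotent (P : Subgroup G) := P.isPGroup'.isNilpotent
  obtain ⟨g, hgP, hgR, hgN⟩ :=
    exists_mem_normalizer_of_lt_of_isNilpotent (lt_of_le_of_ne hRP hne)
  rw [hRnorm] at hgN
  have hle : (Q : Subgroup M) ≤ (P : Subgroup G).subgroupOf M := by
    intro x hx
    exact hRP (mem_map_of_mem M.subtype hx)
  have heq := Q.is_maximal' (P.isPGroup'.comap_of_injective M.subtype M.subtype_injective) hle
  refine hgR (mem_map.mpr ⟨⟨g, hgN⟩, ?_, rfl⟩)
  rw [← heq]
  exact hgP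

/-- Distinct maximal subgroups intersect trivially, if all maximal subgroups of the finite group
are nilpotent and it has no nontrivial solvable normal subgroups. -/
theorem IsCoatom.inf_eq_bot_of_forall_isNilpotent {G : Type*} [Group G] [Finite G]
    (hS : ∀ N : Subgroup G, N.Normal → Group.IsSolvable N → N = ⊥)
    (hnil : ∀ M : Subgroup G, IsCoatom M → Group.IsNilpotent M)
    {M₁ M₂ : Subgroup G} (h₁ : IsCoatom M₁) (h₂ : IsCoatom M₂) (hne : M₁ ≠ M₂) :
    M₁ ⊓ M₂ = ⊥ := by
  suffices h : ∀ I : Subgroup G, ∀ M₁ M₂ : Subgroup G, IsCoatom M₁ → IsCoatom M₂ → M₁ ≠ M₂ →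
      M₁ ⊓ M₂ = I → I = ⊥ from h _ _ _ h₁ h₂ hne rfl
  intro I
  induction I using WellFoundedGT.induction with
  | ind I ih =>
    intro M₁ M₂ h₁ h₂ hne hI
    by_contra hbot
    have hIs : ∀ M : Subgroup G, IsCoatom M → I ≤ M → Group.IsSolvable I := by
      intro M hM hIM
      have := hnil M hM
      exact Group.isSolvable_of_isSolvable_injective (inclusion_injective hIM)
    have hI₁ : I ≤ M₁ := hI ▸ inf_le_left
    have hI₂ : I ≤ M₂ := hI ▸ inf_le_right
    have hN : normalizer (I : Set G) ≠ ⊤ := fun h =>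
      hbot (hS I (normalizer_eq_top_iff.mp h) (hIs M₁ h₁ hI₁))
    obtain ⟨M₃, h₃, hN₃⟩ := (eq_top_or_exists_le_coatom _).resolve_left hN
    have key : ∀ M : Subgroup G, IsCoatom M → I < M → M = M₃ := by
      intro M hM hIM
      by_contra hMne
      have := hnil M hM
      obtain ⟨g, hgM, hgI, hgN⟩ := exists_mem_normalizer_of_lt_of_isNilpotent hIM
      have hlt : I < M ⊓ M₃ := by
        refine lt_of_le_of_ne (le_inf hIM.le (le_normalizer.trans hN₃)) fun h => hgI ?_
        rw [h]
        exact ⟨hgM, hN₃ hgN⟩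
      have h := ih _ hlt M M₃ hM h₃ hMne rfl
      rw [h] at hlt
      exact not_lt_bot hlt
    have hlt₁ : I < M₁ := by
      refine lt_of_le_of_ne hI₁ fun h => hne ?_
      exact (((h₁.le_iff_eq h₂.ne_top).mp (h ▸ hI₂))).symm
    have hlt₂ : I < M₂ := by
      refine lt_of_le_of_ne hI₂ fun h => hne ?_
      exact ((h₂.le_iff_eq h₁.ne_top).mp (h ▸ hI₁))
    exact hne ((key M₁ h₁ hlt₁).trans (key M₂ h₂ hlt₂).symm)

/-- A finite group all of whose maximal subgroups are nilpotent, and which has no nontrivial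
solvable normal subgroups, cannot have maximal subgroups of different orders. -/
theorem IsCoatom.card_eq_of_forall_isNilpotent {G : Type*} [Group G] [Finite G]
    (hS : ∀ N : Subgroup G, N.Normal → Group.IsSolvable N → N = ⊥)
    (hnil : ∀ M : Subgroup G, IsCoatom M → Group.IsNilpotent M)
    {M₁ M₂ : Subgroup G} (h₁ : IsCoatom M₁) (h₂ : IsCoatom M₂)
    (hb₁ : M₁ ≠ ⊥) (hb₂ : M₂ ≠ ⊥) : Nat.card M₁ = Nat.card M₂ := by
  by_contra hcard
  have hconj : ∀ (M : Subgroup G), IsCoatom M → ∀ g : G,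
      IsCoatom (M.map (MulAut.conj g).toMonoidHom) := by
    intro M hM g
    rw [← MulEquiv.coe_mapSubgroup]
    exact ((MulAut.conj g).mapSubgroup.isCoatom_iff M).mpr hM
  have hself : ∀ (M : Subgroup G), IsCoatom M → M ≠ ⊥ → normalizer (M : Set G) = M := by
    intro M hM hb
    refine (hM.le_iff_eq fun h => hb ?_).mp le_normalizer
    have := hnil M hM
    exact hS M (normalizer_eq_top_iff.mp h) inferInstance
  have hmem : ∀ (A B : Subgroup G), IsCoatom A → IsCoatom B → ∀ (a b x y : G), x ∈ A → y ∈ B →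
      x ≠ 1 → a * x * a⁻¹ = b * y * b⁻¹ →
      A.map (MulAut.conj a).toMonoidHom = B.map (MulAut.conj b).toMonoidHom := by
    intro A B hA hB a b x y hx hy hx1 hxy
    by_contra hne
    have h := inf_eq_bot_of_forall_isNilpotent hS hnil (hconj A hA a) (hconj B hB b) hne
    have hz : a * x * a⁻¹ ∈ (⊥ : Subgroup G) := by
      rw [← h]
      exact ⟨⟨x, hx, rfl⟩, ⟨y, hy, hxy.symm⟩⟩
    rw [mem_bot, conj_eq_one_iff] at hz
    exact hx1 hz
  let f (M : Subgroup G) : (G ⧸ M) × {x : M // x ≠ 1} → {x : G // x ≠ 1} := fun c =>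
    ⟨c.1.out * (c.2 : M) * c.1.out⁻¹, fun h => c.2.2 (Subtype.ext (conj_eq_one_iff.mp h))⟩
  have hf : ∀ (M : Subgroup G), IsCoatom M → M ≠ ⊥ → Function.Injective (f M) := by
    rintro M hM hb ⟨c, x, hx⟩ ⟨d, y, hy⟩ hxy
    have hxy' : c.out * (x : G) * c.out⁻¹ = d.out * (y : G) * d.out⁻¹ := congrArg Subtype.val hxy
    have h := hmem M M hM hM _ _ _ _ x.2 y.2 (fun h => hx (Subtype.ext h)) hxy'
    have hcd : c = d := by
      have hN : c.out⁻¹ * d.out ∈ normalizer (M : Set G) := by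
        rw [mem_normalizer_iff_map_conj_eq, map_mul]
        change M.map ((MulAut.conj c.out⁻¹).toMonoidHom.comp (MulAut.conj d.out).toMonoidHom) = M
        rw [← map_map, ← h, map_map]
        convert M.map_id
        ext z
        simp [mul_assoc]
      rw [hself M hM hb, ← QuotientGroup.eq] at hN
      simpa using hN
    subst hcd
    have hxy'' : (x : G) = y := by simpa using hxy'
    have : x = y := Subtype.ext hxy''
    subst this
    rfl
  have hinj : Function.Injective (Sum.elim (f M₁) (f M₂)) := by
    refine (hf M₁ h₁ hb₁).sumElim (hf M₂ h₂ hb₂) ?_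
    rintro ⟨c, x, hx⟩ ⟨d, y, hy⟩ hxy
    have hxy' : c.out * (x : G) * c.out⁻¹ = d.out * (y : G) * d.out⁻¹ := congrArg Subtype.val hxy
    have h := hmem M₁ M₂ h₁ h₂ _ _ _ _ x.2 y.2 (fun h => hx (Subtype.ext h)) hxy'
    apply hcard
    have h' := congrArg (fun H : Subgroup G => Nat.card H) h
    have hinj (g : G) : Function.Injective (MulAut.conj g).toMonoidHom := (MulAut.conj g).injective
    simpa only [card_map_of_injective (hinj _)] using h'
  have hle := Nat.card_le_card_of_injective _ hinj
  have hc : ∀ (K : Type _) [Group K] [Finite K],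
      Nat.card {x : K // x ≠ 1} + 1 = Nat.card K := by
    intro K _ _
    classical
    have := Fintype.ofFinite K
    rw [Nat.card_eq_fintype_card, Nat.card_eq_fintype_card, Fintype.card_subtype_compl]
    have : 0 < Fintype.card K := Fintype.card_pos
    simp
    omega
  rw [Nat.card_sum, Nat.card_prod, Nat.card_prod] at hle
  have e₁ := hc M₁
  have e₂ := hc M₂
  have e := hc G
  have i₁ := M₁.index_mul_card
  have i₂ := M₂.index_mul_card
  rw [index] at i₁ i₂
  have g₁ := M₁.one_lt_card_iff_ne_bot.mpr hb₁
  have g₂ := M₂.one_lt_card_iff_ne_bot.mpr hb₂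
  have a₁ : Nat.card (G ⧸ M₁) ≤ Nat.card (G ⧸ M₁) * Nat.card {x : M₁ // x ≠ 1} :=
    Nat.le_mul_of_pos_right _ (by omega)
  have a₂ : Nat.card (G ⧸ M₂) ≤ Nat.card (G ⧸ M₂) * Nat.card {x : M₂ // x ≠ 1} :=
    Nat.le_mul_of_pos_right _ (by omega)
  rw [← e₁, mul_add, mul_one] at i₁
  rw [← e₂, mul_add, mul_one] at i₂
  omega

/-- A finite group without nontrivial solvable normal subgroups has no nontrivial normal subgroup
`D` such that all maximal subgroups not containing `D` are nilpotent. -/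
theorem Subgroup.eq_bot_of_forall_isCoatom_isNilpotent {G : Type*} [Group G] [Finite G]
    (hS : ∀ N : Subgroup G, N.Normal → Group.IsSolvable N → N = ⊥)
    (D : Subgroup G) [D.Normal]
    (hD : ∀ M : Subgroup G, IsCoatom M → ¬ D ≤ M → Group.IsNilpotent M) : D = ⊥ := by
  by_contra hbot
  have exists_coatom : ∀ p : ℕ, p.Prime → p ∣ Nat.card D →
      ∃ M : Subgroup G, IsCoatom M ∧ ¬ D ≤ M ∧ p ∣ Nat.card M := by
    intro p hp hpD
    have : Fact p.Prime := ⟨hp⟩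
    obtain ⟨P⟩ : Nonempty (Sylow p D) := inferInstance
    set R : Subgroup G := (P : Subgroup D).map D.subtype with hR
    have hcard : Nat.card R = Nat.card P := card_map_of_injective D.subtype_injective
    have hpR : p ∣ Nat.card R := hcard ▸ P.dvd_card_of_dvd_card hpD
    have hsup : normalizer (R : Set G) ⊔ D = ⊤ := Sylow.normalizer_sup_eq_top P
    have hN : normalizer (R : Set G) ≠ ⊤ := by
      intro h
      have : Group.IsNilpotent R := IsPGroup.isNilpotent (p := p) (P.isPGroup'.map _)
      have hRb := hS R (normalizer_eq_top_iff.mp h) inferInstance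
      rw [hRb, card_bot] at hpR
      exact hp.one_lt.ne' (Nat.dvd_one.mp hpR)
    obtain ⟨M, hM, hNM⟩ := (eq_top_or_exists_le_coatom _).resolve_left hN
    refine ⟨M, hM, fun h => hM.ne_top ?_, hpR.trans (card_dvd_of_le (le_normalizer.trans hNM))⟩
    rw [eq_top_iff, ← hsup]
    exact sup_le hNM h
  have index_dvd : ∀ M : Subgroup G, IsCoatom M → ¬ D ≤ M → D.index ∣ Nat.card M := by
    intro M hM hDM
    have hsup : M ⊔ D = ⊤ := codisjoint_iff.mp (hM.not_le_iff_codisjoint.mp hDM)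
    rw [← relIndex_top_right, ← hsup, relIndex_sup_right]
    exact relIndex_dvd_card _ _
  obtain ⟨p₀, hp₀, hpD₀⟩ := Nat.exists_prime_and_dvd (D.one_lt_card_iff_ne_bot.mpr hbot).ne'
  obtain ⟨M₀, hM₀, hDM₀, hpM₀⟩ := exists_coatom p₀ hp₀ hpD₀
  have card_ne : ∃ M : Subgroup G, IsCoatom M ∧ ¬ D ≤ M ∧ M ≠ ⊥ ∧ Nat.card M ≠ Nat.card M₀ := by
    by_contra! hall
    refine hM₀.ne_top (eq_top_of_card_eq _ (Nat.dvd_antisymm (card_subgroup_dvd_card _) ?_))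
    rw [Nat.dvd_iff_prime_pow_dvd_dvd]
    intro p k hp hk
    rcases Nat.eq_zero_or_pos k with rfl | hk0
    · simp
    have : Fact p.Prime := ⟨hp⟩
    obtain ⟨M, hM, hDM, hpM⟩ : ∃ M : Subgroup G, IsCoatom M ∧ ¬ D ≤ M ∧ p ∣ Nat.card M := by
      have hpG : p ∣ D.index * Nat.card D := by
        rw [index_mul_card]
        exact (dvd_pow_self p hk0.ne').trans hk
      rcases hp.dvd_mul.mp hpG with h | h
      · exact ⟨M₀, hM₀, hDM₀, h.trans (index_dvd M₀ hM₀ hDM₀)⟩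
      · exact exists_coatom p hp h
    have := hD M hM hDM
    have hMb : M ≠ ⊥ := by
      rintro rfl
      rw [card_bot] at hpM
      exact hp.one_lt.ne' (Nat.dvd_one.mp hpM)
    obtain ⟨P, hP⟩ := hM.exists_sylow_normalizer_eq hS hpM
    rw [← hall M hM hDM hMb, ← hP]
    refine Dvd.dvd.trans ?_ (card_dvd_of_le (le_normalizer (H := (P : Subgroup G))))
    exact P.pow_dvd_card_of_pow_dvd_card hk
  obtain ⟨M, hM, hDM, hMb, hne⟩ := card_ne
  apply hne
  by_cases hDt : D = ⊤
  · have hnil : ∀ M : Subgroup G, IsCoatom M → Group.IsNilpotent M := by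
      intro M hM
      refine hD M hM fun h => hM.ne_top ?_
      rwa [hDt, top_le_iff] at h
    refine hM.card_eq_of_forall_isNilpotent hS hnil hM₀ hMb ?_
    rintro rfl
    rw [card_bot] at hpM₀
    exact hp₀.one_lt.ne' (Nat.dvd_one.mp hpM₀)
  · obtain ⟨q, hq, hqD⟩ := Nat.exists_prime_and_dvd (fun h => hDt (index_eq_one.mp h))
    have : Fact q.Prime := ⟨hq⟩
    have := hD M hM hDM
    have := hD M₀ hM₀ hDM₀
    obtain ⟨P, hP⟩ := hM.exists_sylow_normalizer_eq hS (hqD.trans (index_dvd M hM hDM))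
    obtain ⟨P₀, hP₀⟩ := hM₀.exists_sylow_normalizer_eq hS (hqD.trans (index_dvd M₀ hM₀ hDM₀))
    have hidx : M.index = M₀.index := by
      rw [← hP, ← hP₀]
      exact P.card_eq_index_normalizer.symm.trans P₀.card_eq_index_normalizer
    have h := M.index_mul_card.trans M₀.index_mul_card.symm
    rw [hidx] at h
    exact Nat.eq_of_mul_eq_mul_left (Nat.pos_of_ne_zero index_ne_zero_of_finite) h

/-- Nilpotency of a subgroup can be checked on its preimage under a surjective homomorphism. -/
theorem Subgroup.isNilpotent_of_comap_s13 {G H : Type*} [Group G] [Group H] {f : G →* H}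
    (hf : Function.Surjective f) {M : Subgroup H} (h : Group.IsNilpotent (M.comap f)) :
    Group.IsNilpotent M :=
  Group.nilpotent_of_surjective (f.subgroupComap M)
    (f.subgroupComap_surjective_of_surjective M hf)

/-- If all maximal subgroups not containing the normal subgroup `D` of a finite group are
nilpotent, then `D` is solvable. -/
theorem Subgroup.isSolvable_of_forall_isCoatom_isNilpotent {G : Type u} [Group G] [Finite G]
    (D : Subgroup G) [hDn : D.Normal]
    (hD : ∀ M : Subgroup G, IsCoatom M → ¬ D ≤ M → Group.IsNilpotent M) :
    Group.IsSolvable D := by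
  suffices h : ∀ (n : ℕ) (G : Type u) [Group G] [Finite G], Nat.card G = n →
      ∀ D : Subgroup G, D.Normal →
        (∀ M : Subgroup G, IsCoatom M → ¬ D ≤ M → Group.IsNilpotent M) → Group.IsSolvable D from
    h _ G rfl D hDn hD
  clear hD hDn D
  intro n
  induction n using Nat.strong_induction_on with
  | h n ih =>
    intro G _ _ hn D _ hD
    by_cases hS : ∀ N : Subgroup G, N.Normal → Group.IsSolvable N → N = ⊥
    · rw [eq_bot_of_forall_isCoatom_isNilpotent hS D hD]
      infer_instance
    push Not at hS
    obtain ⟨N, hN, hNs, hNb⟩ := hS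
    let π := QuotientGroup.mk' N
    have hπ : Function.Surjective π := QuotientGroup.mk'_surjective N
    have hlt : Nat.card (G ⧸ N) < n := by
      have h1 := N.one_lt_card_iff_ne_bot.mpr hNb
      have h2 : Nat.card (G ⧸ N) * Nat.card N = Nat.card G := N.index_mul_card
      have h3 : 0 < Nat.card (G ⧸ N) := Nat.card_pos
      nlinarith
    have hsol : Group.IsSolvable (D.map π) := by
      refine ih _ hlt (G ⧸ N) rfl _ (Normal.map inferInstance π hπ) fun M hM hDM => ?_
      refine isNilpotent_of_comap_s13 hπ (hD _ (isCoatom_comap_of_surjective hπ hM) ?_)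
      rwa [← map_le_iff_le_comap]
    have : Group.IsSolvable (N.subgroupOf D) :=
      Group.isSolvable_of_isSolvable_injective (f := D.subtype.subgroupComap N) fun x y h =>
        Subtype.ext (Subtype.ext (congrArg (fun z : N => (z : G)) h))
    refine Group.isSolvable_of_ker_le_range (N.subgroupOf D).subtype (π.subgroupMap D) ?_
    intro x hx
    rw [range_subtype, mem_subgroupOf]
    exact (QuotientGroup.eq_one_iff (x : G)).mp (congrArg Subtype.val hx)

/-- The intersection of the non-nilpotent maximal subgroups is normal. -/
theorem Subgroup.normal_sInf_isCoatom_not_isNilpotent (G : Type*) [Group G] :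
    (sInf {M : Subgroup G | IsCoatom M ∧ ¬ Group.IsNilpotent M}).Normal := by
  refine ⟨fun x hx g => ?_⟩
  rw [mem_sInf] at hx ⊢
  rintro M ⟨hM, hMn⟩
  have hsurj : Function.Surjective (MulAut.conj g).toMonoidHom := (MulAut.conj g).surjective
  exact hx _ ⟨isCoatom_comap_of_surjective hsurj hM, fun h => hMn (isNilpotent_of_comap_s13 hsurj h)⟩

theorem stmt13 {G : Type*} [Group G] [Fintype G] (hG : ¬ IsSolvable G) :
    sInf {M : Subgroup G | IsCoatom M ∧ ¬ Group.IsNilpotent ↥M} = frattini G := by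
  apply le_antisymm
  · set D := sInf {M : Subgroup G | IsCoatom M ∧ ¬ Group.IsNilpotent M} with hDdef
    have : D.Normal := normal_sInf_isCoatom_not_isNilpotent G
    have hD : ∀ M : Subgroup G, IsCoatom M → ¬ D ≤ M → Group.IsNilpotent M := by
      intro M hM hDM
      by_contra h
      exact hDM (sInf_le ⟨hM, h⟩)
    have hDs := isSolvable_of_forall_isCoatom_isNilpotent D hD
    refine le_iInf₂ fun M hM => ?_
    by_contra hDM
    have := hD M hM hDM
    have hsup : M ⊔ D = ⊤ := codisjoint_iff.mp (hM.not_le_iff_codisjoint.mp hDM)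
    have hsurj : Function.Surjective ((QuotientGroup.mk' D).comp M.subtype) := by
      rw [← MonoidHom.range_eq_top, MonoidHom.range_comp, range_subtype]
      have h := congrArg (Subgroup.map (QuotientGroup.mk' D)) hsup
      rwa [Subgroup.map_sup, QuotientGroup.map_mk'_self, sup_bot_eq, ← MonoidHom.range_eq_map,
        QuotientGroup.range_mk'] at h
    have : Group.IsSolvable (G ⧸ D) := Group.isSolvable_of_surjective hsurj
    refine hG (Group.isSolvable_of_ker_le_range D.subtype (QuotientGroup.mk' D) ?_)
    rw [QuotientGroup.ker_mk', range_subtype]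
  · exact le_sInf fun M hM => frattini_le_coatom hM.1
end
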